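/- arXiv:1110.1003 — 2 statements merged into one kernel-verified Lean document; each statement's English description precedes it below -/
import Mathlib

section
/- Let A_i be a nowhere dense closed subset of an h-homogeneous metric space (X_i, ρ_i) for i ∈ {1, 2}, and let g : X₁ → X₂ be a homeomorphism such that g(A₁) = A₂. Then for every homeomorphism f₀ : A₁ → A₂ and every ε > 0 satisfying ρ₁(g⁻¹|A₂, f₀⁻¹) + ρ₂(g|A₁, f₀) < ε, there exists a homeomorphism f : X₁ → X₂ such that f restricted to A₁ equals f₀ and ρ₁(g⁻¹, f⁻¹) + ρ₂(g, f) < ε. -/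
open Topology Set Filter

universe u v

noncomputable section

/-- Strong zero-dimensionality (`Ind X = 0`): any two disjoint closed sets
can be separated by a clopen set. -/
def StronglyZeroDim (X : Type*) [TopologicalSpace X] : Prop :=
  ∀ A B : Set X, IsClosed A → IsClosed B → Disjoint A B →
    ∃ U : Set X, IsClopen U ∧ A ⊆ U ∧ Disjoint B U

/-- The topological weight of a space: the least cardinality of a base. -/
def topWeight (X : Type u) [TopologicalSpace X] : Cardinal.{u} :=
  ⨅ B : {B : Set (Set X) // TopologicalSpace.IsTopologicalBasis B}, Cardinal.mk B.1

/-- The space has a base of cardinality `< k`. -/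
def WeightLT (X : Type u) [TopologicalSpace X] (k : Cardinal.{u}) : Prop :=
  ∃ B : Set (Set X), TopologicalSpace.IsTopologicalBasis B ∧ Cardinal.mk B < k

/-- Every point has a neighborhood of weight `< k`. -/
def LocallyWeightLT (X : Type u) [TopologicalSpace X] (k : Cardinal.{u}) : Prop :=
  ∀ x : X, ∃ s : Set X, s ∈ nhds x ∧ WeightLT ↥s k

/-- `X ∈ σLW(<k)`: `X` is a countable union of subspaces, each locally of weight `< k`. -/
def SigmaLW (X : Type u) [TopologicalSpace X] (k : Cardinal.{u}) : Prop :=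
  ∃ S : ℕ → Set X, (⋃ n, S n) = Set.univ ∧ ∀ n, LocallyWeightLT ↥(S n) k

/-- A `G_δσ`-subset: a countable union of `G_δ`-sets. -/
def IsGdeltaSigma {Y : Type*} [TopologicalSpace Y] (s : Set Y) : Prop :=
  ∃ G : ℕ → Set Y, (∀ n, IsGδ (G n)) ∧ s = ⋃ n, G n

/-- An `F_σ`-subset: a countable union of closed sets. -/
def IsFsigmaSet {Y : Type*} [TopologicalSpace Y] (s : Set Y) : Prop :=
  ∃ F : ℕ → Set Y, (∀ n, IsClosed (F n)) ∧ s = ⋃ n, F n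

/-- An `F_σδ`-subset: a countable intersection of `F_σ`-sets. -/
def IsFsigmaDelta {Y : Type*} [TopologicalSpace Y] (s : Set Y) : Prop :=
  ∃ F : ℕ → Set Y, (∀ n, IsFsigmaSet (F n)) ∧ s = ⋂ n, F n

/-- An absolute `G_δσ`-set: a metrizable space whose image under every embedding
into a metrizable space is a countable union of `G_δ`-sets. -/
def AbsGdeltaSigma (X : Type u) [TopologicalSpace X] : Prop :=
  TopologicalSpace.MetrizableSpace X ∧
    ∀ (Y : Type u) [TopologicalSpace Y] [TopologicalSpace.MetrizableSpace Y]
      (f : X → Y), Topology.IsEmbedding f → IsGdeltaSigma (Set.range f)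

/-- An absolute `F_σδ`-set: a metrizable space whose image under every embedding
into a metrizable space is an `F_σδ`-set. -/
def AbsFsigmaDelta (X : Type u) [TopologicalSpace X] : Prop :=
  TopologicalSpace.MetrizableSpace X ∧
    ∀ (Y : Type u) [TopologicalSpace Y] [TopologicalSpace.MetrizableSpace Y]
      (f : X → Y), Topology.IsEmbedding f → IsFsigmaDelta (Set.range f)

/-- `X ∈ σLW(<k) + 𝒢_δσ` : `X = A ∪ B` with `A ∈ σLW(<k)` and `B` an absolute
`G_δσ`-set. -/
def SLWplusGDS (X : Type u) [TopologicalSpace X] (k : Cardinal.{u}) : Prop :=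
  ∃ A B : Set X, A ∪ B = Set.univ ∧ SigmaLW ↥A k ∧ AbsGdeltaSigma ↥B

/-- No nonempty open subspace is `σLW(<k) + 𝒢_δσ`. -/
def NowhereSLWplusGDS (X : Type u) [TopologicalSpace X] (k : Cardinal.{u}) : Prop :=
  ∀ U : Set X, IsOpen U → U.Nonempty → ¬ SLWplusGDS ↥U k

/-- A space is of first category if it is meager in itself. -/
def FirstCategory (X : Type*) [TopologicalSpace X] : Prop :=
  IsMeagre (Set.univ : Set X)

/-- A Souslin (analytic) subset of a space:
`s = ⋃_{t ∈ ω^ω} ⋂_n F(t↾n)` for a family of closed sets indexed by finite tuples. -/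
def IsSuslinIn {Y : Type*} [TopologicalSpace Y] (s : Set Y) : Prop :=
  ∃ F : List ℕ → Set Y, (∀ l, IsClosed (F l)) ∧
    s = ⋃ t : ℕ → ℕ, ⋂ n : ℕ, F (List.ofFn fun i : Fin n => t i)

/-- An absolute Souslin space: metrizable, and Souslin in every completely metrizable
space into which it embeds. -/
def AbsSuslin (X : Type u) [TopologicalSpace X] : Prop :=
  TopologicalSpace.MetrizableSpace X ∧
    ∀ (Y : Type u) [MetricSpace Y] [CompleteSpace Y] (f : X → Y),
      Topology.IsEmbedding f → IsSuslinIn (Set.range f)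

/-- An h-homogeneous space: every nonempty clopen subset is homeomorphic to the
whole space. -/
def HHomogeneous (X : Type*) [TopologicalSpace X] : Prop :=
  ∀ U : Set X, IsClopen U → U.Nonempty → Nonempty (↥U ≃ₜ X)

/-- A discrete family of sets: every point has a neighborhood meeting at most one
member of the family. -/
def DiscreteFamily {X : Type*} [TopologicalSpace X] {ι : Type*} (f : ι → Set X) : Prop :=
  ∀ x : X, ∃ U ∈ nhds x, {i | (f i ∩ U).Nonempty}.Subsingleton

/-- A discrete space of cardinality `k`. -/
def DiscT (k : Cardinal.{u}) : Type u := k.out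

instance (k : Cardinal.{u}) : TopologicalSpace (DiscT k) := ⊥
instance (k : Cardinal.{u}) : DiscreteTopology (DiscT k) := ⟨rfl⟩

/-- The Baire space `B(k) = k^ω`. -/
def BaireB (k : Cardinal.{u}) : Type u := ℕ → DiscT k

instance (k : Cardinal.{u}) : TopologicalSpace (BaireB k) :=
  inferInstanceAs (TopologicalSpace (ℕ → DiscT k))

open Classical in
/-- The discrete factor of `B*(k)`: two points if `k = ℵ₀`, and `k` points otherwise. -/
def StarT (k : Cardinal.{u}) : Type u :=
  if k = Cardinal.aleph0 then ULift Bool else DiscT k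

instance (k : Cardinal.{u}) : TopologicalSpace (StarT k) := ⊥
instance (k : Cardinal.{u}) : DiscreteTopology (StarT k) := ⟨rfl⟩

/-- `B*(k)`: the Cantor set `2^ω` if `k = ℵ₀`, and the Baire space `B(k)` if `k > ℵ₀`. -/
def BaireStar (k : Cardinal.{u}) : Type u := ℕ → StarT k

instance (k : Cardinal.{u}) : TopologicalSpace (BaireStar k) :=
  inferInstanceAs (TopologicalSpace (ℕ → StarT k))

/-- A discrete space of cardinality `k` (for infinite `k`), with a distinguished basepoint. -/
def QBase (k : Cardinal.{u}) : Type u := DiscT k ⊕ PUnit.{u + 1}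

instance (k : Cardinal.{u}) : TopologicalSpace (QBase k) := ⊥
instance (k : Cardinal.{u}) : DiscreteTopology (QBase k) := ⟨rfl⟩

/-- `Q(k)`: the σ-product of `ω` copies of a discrete space of cardinality `k`, i.e.
the subspace of the product consisting of the sequences eventually equal to the basepoint. -/
def Qk (k : Cardinal.{u}) : Type u :=
  {x : ℕ → QBase k // ∀ᶠ n in Filter.atTop, x n = Sum.inr PUnit.unit}

instance (k : Cardinal.{u}) : TopologicalSpace (Qk k) :=
  inferInstanceAs (TopologicalSpace
    {x : ℕ → QBase k // ∀ᶠ n in Filter.atTop, x n = Sum.inr PUnit.unit})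

/-- The countable power `Q(k)^ω`. -/
def QkOmega (k : Cardinal.{u}) : Type u := ℕ → Qk k

instance (k : Cardinal.{u}) : TopologicalSpace (QkOmega k) :=
  inferInstanceAs (TopologicalSpace (ℕ → Qk k))

/-- `Z` is homeomorphic to `Q(k)^ω`. -/
def IsQkOmega (k : Cardinal.{u}) (Z : Type*) [TopologicalSpace Z] : Prop :=
  Nonempty (Z ≃ₜ QkOmega k)

/-- `Z` is homeomorphic to `A^{II}_k`, the complement in `B*(k)` of a dense copy of
`Q(k)^ω`. -/
def IsAII (k : Cardinal.{u}) (Z : Type*) [TopologicalSpace Z] : Prop :=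
  ∃ A : Set (BaireStar k), Dense A ∧ IsQkOmega k ↥A ∧ Nonempty (Z ≃ₜ ↥(Aᶜ))

/-- `Z` is homeomorphic to `A^I_k = Q × A^{II}_k`. -/
def IsAI (k : Cardinal.{u}) (Z : Type*) [TopologicalSpace Z] : Prop :=
  ∃ A : Set (BaireStar k), Dense A ∧ IsQkOmega k ↥A ∧ Nonempty (Z ≃ₜ (ℚ × ↥(Aᶜ)))

/-- `Z` is homeomorphic to `M^{II}_k`, the complement in `B*(k)` of a dense copy of
`A^I_k`. -/
def IsMII (k : Cardinal.{u}) (Z : Type*) [TopologicalSpace Z] : Prop :=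
  ∃ Y : Set (BaireStar k), Dense Y ∧ IsAI k ↥Y ∧ Nonempty (Z ≃ₜ ↥(Yᶜ))

/-- `X ∈ 𝓕_σδ ∖ σLW(<k)`: `X` is homeomorphic to `F ∖ L` for some absolute
`F_σδ`-space `F` and some `L ⊆ F` with `L ∈ σLW(<k)`. -/
def FsdMinusSLW (X : Type u) [TopologicalSpace X] (k : Cardinal.{u}) : Prop :=
  ∃ (F : TopCat.{u}) (L : Set F), AbsFsigmaDelta ↥F ∧ SigmaLW ↥L k ∧
    Nonempty (X ≃ₜ ↥(Lᶜ))

/-- No nonempty open subspace is in the class `𝓕_σδ ∖ σLW(<k)`. -/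
def NowhereFsdMinusSLW (X : Type u) [TopologicalSpace X] (k : Cardinal.{u}) : Prop :=
  ∀ U : Set X, IsOpen U → U.Nonempty → ¬ FsdMinusSLW ↥U k

/-- A topologically complete (i.e. completely metrizable) space. -/
def CompletelyMetrizable (X : Type*) [t : TopologicalSpace X] : Prop :=
  ∃ m : MetricSpace X, m.toUniformSpace.toTopologicalSpace = t ∧
    @CompleteSpace X m.toUniformSpace

end

/-- Every open cover has a locally constant selection. -/
theorem aux_cover {X : Type*} {ι : Type*} [MetricSpace X] (hz : StronglyZeroDim X)
    (U : ι → Set X) (ho : ∀ i, IsOpen (U i)) (hc : ⋃ i, U i = univ) :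
    ∃ p : X → ι, IsLocallyConstant p ∧ ∀ x, x ∈ U (p x) := by
  classical
  obtain ⟨v, vo, vc, vf, vu⟩ := precise_refinement U ho hc
  obtain ⟨w, wc, wcl, wv⟩ := exists_iUnion_eq_closed_subset vo (fun x => vf.point_finite x) vc
  have h1 : ∀ i, ∃ V : Set X, IsClopen V ∧ w i ⊆ V ∧ V ⊆ v i := by
    intro i
    obtain ⟨V, hV, h1, h2⟩ := hz (w i) (v i)ᶜ (wcl i) (vo i).isClosed_compl
      (disjoint_compl_right_iff_subset.2 (wv i))
    exact ⟨V, hV, h1, by rwa [disjoint_compl_left_iff_subset] at h2⟩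
  choose V hV hwV hVv using h1
  have hne : ∀ x, {i | x ∈ V i}.Nonempty := by
    intro x
    have : x ∈ ⋃ i, w i := by rw [wc]; trivial
    obtain ⟨i, hi⟩ := mem_iUnion.1 this
    exact ⟨i, hwV i hi⟩
  have hlc : IsLocallyConstant (fun x => {i | x ∈ V i}) := by
    rw [IsLocallyConstant.iff_eventually_eq]
    intro x
    obtain ⟨N, hN, hfin⟩ := vf x
    have h2 : ∀ᶠ y in 𝓝 x, ∀ i ∈ {i | (v i ∩ N).Nonempty}, (y ∈ V i ↔ x ∈ V i) := by
      rw [Filter.eventually_all_finite hfin]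
      intro i _
      by_cases hx : x ∈ V i
      · filter_upwards [(hV i).isOpen.mem_nhds hx] with y hy
        simp [hx, hy]
      · filter_upwards [(hV i).compl.isOpen.mem_nhds hx] with y hy
        have : y ∉ V i := hy
        simp [hx, this]
    filter_upwards [h2, hN] with y hy hyN
    ext i
    by_cases hi : (v i ∩ N).Nonempty
    · exact hy i hi
    · have a1 : y ∉ V i := fun h => hi ⟨y, hVv i h, hyN⟩
      have a2 : x ∉ V i := fun h => hi ⟨x, hVv i h, mem_of_mem_nhds hN⟩
      simp [a1, a2]
  by_cases hX : Nonempty X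
  · obtain ⟨x0⟩ := hX
    let c : Set ι → ι := fun s => if h : s.Nonempty then h.some else (hne x0).some
    refine ⟨c ∘ (fun x => {i | x ∈ V i}), hlc.comp c, fun x => ?_⟩
    have : c {i | x ∈ V i} ∈ {i | x ∈ V i} := by
      simp only [c, dif_pos (hne x)]
      exact (hne x).some_mem
    exact vu _ (hVv _ this)
  · refine ⟨fun x => (hX ⟨x⟩).elim, ?_, fun x => (hX ⟨x⟩).elim⟩
    rw [IsLocallyConstant.iff_eventually_eq]
    exact fun x => (hX ⟨x⟩).elim

theorem aux_section {X S : Type*} [MetricSpace X] (A : Set X) (hA : IsClosed A)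
    (hA' : IsNowhereDense A) (G : Set X) (hG : IsOpen G) (hAG : A ⊆ G)
    (k : X → S) (hk : IsLocallyConstant k) :
    ∃ Y : Set X, IsClosed Y ∧ Y ⊆ G ∧ Disjoint A Y ∧ ∀ a ∈ A, ∃ y ∈ Y, k y = k a := by
  have h : ∀ a : A, ∃ y, y ∈ G ∧ y ∉ A ∧ k y = k a := by
    intro a
    by_contra hcon
    push Not at hcon
    have hsub : G ∩ {y | k y = k a} ⊆ A := by
      rintro y ⟨hy, hy'⟩
      by_contra hyA
      exact hcon y hy hyA hy'
    have := interior_maximal hsub (hG.inter (hk.isOpen_fiber _))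
    rw [(hA.isNowhereDense_iff).1 hA'] at this
    exact this ⟨hAG a.2, rfl⟩
  have h' : ∀ s : k '' A, ∃ y, y ∈ G ∧ y ∉ A ∧ k y = s := by
    rintro ⟨_, a, ha, rfl⟩
    exact h ⟨a, ha⟩
  choose t ht1 ht2 ht3 using h'
  refine ⟨range t, ?_, ?_, ?_, ?_⟩
  · rw [← isOpen_compl_iff, isOpen_iff_mem_nhds]
    intro x hx
    by_cases hs : k x ∈ k '' A
    · have hne : x ≠ t ⟨k x, hs⟩ := fun h => hx ⟨_, h.symm⟩
      filter_upwards [(hk.isOpen_fiber (k x)).mem_nhds rfl, isOpen_ne.mem_nhds hne] with y hy hy2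
      rintro ⟨s, rfl⟩
      have : s = ⟨k x, hs⟩ := Subtype.ext ((ht3 s).symm.trans hy)
      exact hy2 (by rw [this])
    · filter_upwards [(hk.isOpen_fiber (k x)).mem_nhds rfl] with y hy
      rintro ⟨s, rfl⟩
      apply hs
      rw [← show k (t s) = k x from hy, ht3 s]
      exact s.2
  · rintro _ ⟨s, rfl⟩; exact ht1 s
  · rw [Set.disjoint_right]; rintro _ ⟨s, rfl⟩; exact ht2 s
  · intro a ha
    exact ⟨_, ⟨⟨k a, mem_image_of_mem k ha⟩, rfl⟩, ht3 _⟩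

theorem aux_step {X S : Type*} [MetricSpace X] (hz : StronglyZeroDim X) (A : Set X)
    (hA : IsClosed A) (hA' : IsNowhereDense A) (G H : Set X) (hG : IsClopen G) (hAG : A ⊆ G)
    (hH : IsClopen H) (hAH : A ⊆ H)
    (k₁ k₂ : X → S) (hk₁ : IsLocallyConstant k₁) (hk₂ : IsLocallyConstant k₂) :
    ∃ G' : Set X, (IsClopen G' ∧ A ⊆ G') ∧ G' ⊆ G ∧ G' ⊆ H ∧
      (∀ a ∈ A, ∃ y ∈ G \ G', k₁ y = k₁ a) ∧ (∀ a ∈ A, ∃ y ∈ G \ G', k₂ y = k₂ a) := by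
  obtain ⟨Y, hY, hYG, hYA, hYk⟩ := aux_section A hA hA' G hG.isOpen hAG k₁ hk₁
  obtain ⟨Z, hZ, hZG, hZA, hZk⟩ := aux_section A hA hA' G hG.isOpen hAG k₂ hk₂
  obtain ⟨U, hU, hAU, hYU⟩ := hz A (Y ∪ Z) hA (hY.union hZ) (hYA.union_right hZA)
  refine ⟨G ∩ H ∩ U, ⟨(hG.inter hH).inter hU, fun a ha => ⟨⟨hAG ha, hAH ha⟩, hAU ha⟩⟩,
    fun x hx => hx.1.1, fun x hx => hx.1.2, ?_, ?_⟩
  · intro a ha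
    obtain ⟨y, hy, hya⟩ := hYk a ha
    exact ⟨y, ⟨hYG hy, fun h => Set.disjoint_left.1 hYU (Or.inl hy) h.2⟩, hya⟩
  · intro a ha
    obtain ⟨y, hy, hya⟩ := hZk a ha
    exact ⟨y, ⟨hZG hy, fun h => Set.disjoint_left.1 hYU (Or.inr hy) h.2⟩, hya⟩

theorem aux_glue {X S : Type*} [MetricSpace X] (A : Set X)
    (φ : A ≃ₜ A) (k₁ k₂ : X → S) (h₁ : ∀ s, IsOpen {x | x ∉ A ∧ k₁ x = s})
    (h₂ : ∀ s, IsOpen {x | x ∉ A ∧ k₂ x = s})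
    (e : ∀ s, {x | x ∉ A ∧ k₁ x = s} ≃ₜ {x | x ∉ A ∧ k₂ x = s}) :
    ∃ F : X ≃ X, (∀ a : A, F a = φ a) ∧ (∀ a : A, F.symm a = φ.symm a) ∧
      (∀ x (h : x ∉ A), F x = e (k₁ x) ⟨x, h, rfl⟩) ∧
      (∀ x (h : x ∉ A), F.symm x = (e (k₂ x)).symm ⟨x, h, rfl⟩) ∧
      (∀ x, x ∉ A → ContinuousAt F x) ∧ (∀ x, x ∉ A → ContinuousAt F.symm x) := by
  classical
  let f : X → X := fun x => if h : x ∈ A then φ ⟨x, h⟩ else e (k₁ x) ⟨x, h, rfl⟩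
  let f' : X → X := fun x => if h : x ∈ A then φ.symm ⟨x, h⟩ else (e (k₂ x)).symm ⟨x, h, rfl⟩
  have fs : ∀ s (x : {x | x ∉ A ∧ k₁ x = s}), f x = e s x := by
    rintro s ⟨x, hx, rfl⟩
    simp [f, hx]
  have fs' : ∀ s (x : {x | x ∉ A ∧ k₂ x = s}), f' x = (e s).symm x := by
    rintro s ⟨x, hx, rfl⟩
    simp [f', hx]
  have fa : ∀ a : A, f a = φ a := by intro a; simp [f]
  have fa' : ∀ a : A, f' a = φ.symm a := by intro a; simp [f']
  refine ⟨⟨f, f', ?_, ?_⟩, fa, fa', fun x h => fs _ ⟨x, h, rfl⟩, fun x h => fs' _ ⟨x, h, rfl⟩,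
    ?_, ?_⟩
  · intro x
    by_cases h : x ∈ A
    · rw [show f x = φ ⟨x, h⟩ from fa ⟨x, h⟩, fa']; simp
    · rw [show f x = _ from fs _ ⟨x, h, rfl⟩, fs']; simp
  · intro x
    by_cases h : x ∈ A
    · rw [show f' x = φ.symm ⟨x, h⟩ from fa' ⟨x, h⟩, fa]; simp
    · rw [show f' x = _ from fs' _ ⟨x, h, rfl⟩, fs]; simp
  · intro x hx
    have : ContinuousOn f {y | y ∉ A ∧ k₁ y = k₁ x} := by
      rw [continuousOn_iff_continuous_domRestrict]
      have : Set.domRestrict {y | y ∉ A ∧ k₁ y = k₁ x} f = fun y => ((e (k₁ x) y : _) : X) := by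
        funext y; exact fs _ y
      rw [this]
      exact continuous_subtype_val.comp (e (k₁ x)).continuous
    exact this.continuousAt ((h₁ _).mem_nhds ⟨hx, rfl⟩)
  · intro x hx
    have : ContinuousOn f' {y | y ∉ A ∧ k₂ y = k₂ x} := by
      rw [continuousOn_iff_continuous_domRestrict]
      have : Set.domRestrict {y | y ∉ A ∧ k₂ y = k₂ x} f' =
          fun y => (((e (k₂ x)).symm y : _) : X) := by
        funext y; exact fs' _ y
      rw [this]
      exact continuous_subtype_val.comp (e (k₂ x)).symm.continuous
    exact this.continuousAt ((h₂ _).mem_nhds ⟨hx, rfl⟩)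

theorem aux_cont {X : Type*} [MetricSpace X] (A : Set X) (φ : A → A) (hφ : Continuous φ)
    (f : X → X) (hf : ∀ a : A, f a = φ a) (G : ℕ → Set X) (hG : ∀ n, IsOpen (G n))
    (hAG : ∀ n, A ⊆ G n) (δ : ℝ) (hδ : 0 < δ)
    (h : ∀ n, ∀ x ∈ G n, x ∉ A → ∃ a : A, dist x a < δ / (n + 1) ∧ dist (f x) (φ a) < δ / (n + 1))
    (a : A) : ContinuousAt f a := by
  rw [Metric.continuousAt_iff']
  intro r hr
  obtain ⟨d, hd, hd'⟩ := Metric.continuousAt_iff.1 (hφ.continuousAt (x := a)) (r / 2) (half_pos hr)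
  obtain ⟨n, hn⟩ := exists_nat_gt (δ / min (d / 2) (r / 2))
  have hm : 0 < min (d / 2) (r / 2) := lt_min (half_pos hd) (half_pos hr)
  have hlt : δ / (n + 1) < min (d / 2) (r / 2) := by
    rw [div_lt_iff₀ hm] at hn
    rw [div_lt_iff₀ (by positivity)]
    nlinarith
  have l1 := lt_of_lt_of_le hlt (min_le_left _ _)
  have l2 := lt_of_lt_of_le hlt (min_le_right _ _)
  filter_upwards [(hG n).mem_nhds (hAG n a.2), Metric.ball_mem_nhds (a : X) (half_pos hd)]
    with x hx hxa
  rw [hf a]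
  rw [Metric.mem_ball] at hxa
  by_cases hxA : x ∈ A
  · have := hd' (x := ⟨x, hxA⟩) (by rw [Subtype.dist_eq]; simp only; linarith)
    rw [Subtype.dist_eq] at this
    rw [show f x = φ ⟨x, hxA⟩ from hf ⟨x, hxA⟩]
    linarith
  · obtain ⟨b, hb1, hb2⟩ := h n x hx hxA
    have h3 : dist b a < d := by
      rw [Subtype.dist_eq]
      have := dist_triangle_left (b : X) a x
      linarith
    have h4 := hd' h3
    rw [Subtype.dist_eq] at h4
    have := dist_triangle (f x) (φ b) (φ a)
    linarith

theorem aux_pq {X : Type*} [MetricSpace X] (hz : StronglyZeroDim X) (A : Set X)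
    (hA : IsClosed A) (φ : A ≃ₜ A) (φ' : X → X) (hφ' : ∀ a : A, φ' a = φ a)
    (η : ℝ) (hη : 0 < η) :
    ∃ p q : X → X, IsLocallyConstant p ∧ IsLocallyConstant q ∧ (∀ x, dist x (q x) < η) ∧
      (∀ x, p x ∈ A → dist x (p x) < η) ∧ (∀ a ∈ A, p a ∈ A) ∧
      (∀ a ∈ A, q (p a) = q a) ∧ (∀ a ∈ A, q (φ' (p a)) = q (φ' a)) := by
  classical
  obtain ⟨q, hq, hq'⟩ := aux_cover hz (fun x : X => Metric.ball x η) (fun _ => Metric.isOpen_ball)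
    (by rw [eq_univ_iff_forall]; intro x; exact mem_iUnion.2 ⟨x, Metric.mem_ball_self hη⟩)
  have h1 : ∀ a : A, ∃ U : Set X, IsOpen U ∧ (a : X) ∈ U ∧ (∀ x ∈ U, dist x a < η) ∧
      (∀ x ∈ U, x ∈ A → q a = q x ∧ q (φ' a) = q (φ' x)) := by
    intro a
    have c1 : IsLocallyConstant (fun b : A => q b) := hq.comp_continuous continuous_subtype_val
    have c2 : IsLocallyConstant (fun b : A => q (φ b)) :=
      hq.comp_continuous (continuous_subtype_val.comp φ.continuous)
    have ho := (c1.isOpen_fiber (q a)).inter (c2.isOpen_fiber (q (φ a)))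
    obtain ⟨U, hU, hU'⟩ := isOpen_induced_iff.1 ho
    have hmem : ∀ b : A, (b : X) ∈ U ↔ q b = q a ∧ q (φ b) = q (φ a) := by
      intro b
      exact Set.ext_iff.1 hU' b
    refine ⟨U ∩ Metric.ball a η, hU.inter Metric.isOpen_ball,
      ⟨(hmem a).2 ⟨rfl, rfl⟩, Metric.mem_ball_self hη⟩, fun x hx => hx.2, ?_⟩
    intro x hx hxA
    have := (hmem ⟨x, hxA⟩).1 hx.1
    refine ⟨this.1.symm, ?_⟩
    rw [hφ' a, show φ' x = φ ⟨x, hxA⟩ from hφ' ⟨x, hxA⟩]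
    exact this.2.symm
  choose U hU haU hUd hUq using h1
  obtain ⟨p, hp, hp'⟩ := aux_cover hz (fun x : X => if h : x ∈ A then U ⟨x, h⟩ else Aᶜ)
    (by
      intro x
      by_cases h : x ∈ A
      · simp only [h, dif_pos]; exact hU _
      · simp only [h]; exact hA.isOpen_compl)
    (by
      rw [eq_univ_iff_forall]; intro x
      refine mem_iUnion.2 ⟨x, ?_⟩
      by_cases h : x ∈ A
      · simp only [h, dif_pos]; exact haU ⟨x, h⟩
      · simp [h])
  have hpU : ∀ x (h : p x ∈ A), x ∈ U ⟨p x, h⟩ := by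
    intro x h
    have := hp' x
    simpa only [h, dif_pos] using this
  have hpA : ∀ a ∈ A, p a ∈ A := by
    intro a ha
    by_contra h
    have := hp' a
    simp only [h, dif_neg, not_false_eq_true] at this
    exact this ha
  exact ⟨p, q, hp, hq, fun x => hq' x, fun x h => hUd _ _ (hpU x h), hpA,
    fun a ha => (hUq _ _ (hpU a (hpA a ha)) ha).1, fun a ha => (hUq _ _ (hpU a (hpA a ha)) ha).2⟩

theorem aux_main {X : Type*} [MetricSpace X] (hz : StronglyZeroDim X) (hh : HHomogeneous X)
    (A : Set X) (hA : IsClosed A) (hA' : IsNowhereDense A) (φ : A ≃ₜ A) (δ : ℝ) (hδ : 0 < δ) :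
    ∃ F : X ≃ₜ X, (∀ a : A, F a = φ a) ∧
      ∀ x, F x = x ∨ ∃ a : A, dist x a < δ ∧ dist (F x) (φ a) < δ := by
  classical
  let φ' : X → X := fun x => if h : x ∈ A then φ ⟨x, h⟩ else x
  have hφ' : ∀ a : A, φ' a = φ a := by intro a; simp [φ']
  have hη : ∀ n : ℕ, 0 < δ / (n + 1) / 3 := fun n => by positivity
  choose p q hp hq hqd hpd hpA hqp hqp' using
    fun n : ℕ => aux_pq hz A hA φ φ' hφ' (δ / (n + 1) / 3) (hη n)
  let H : ℕ → Set X := fun n => {x | p n x ∈ A}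
  have hH : ∀ n, IsClopen (H n) := fun n => ⟨⟨hp n Aᶜ⟩, hp n A⟩
  have hAH : ∀ n, A ⊆ H n := fun n a ha => hpA n a ha
  let k₁ : ℕ → X → X := fun n => q n ∘ φ' ∘ p n
  let k₂ : ℕ → X → X := fun n => q n ∘ p n
  have hk₁ : ∀ n, IsLocallyConstant (k₁ n) := fun n => (hp n).comp (q n ∘ φ')
  have hk₂ : ∀ n, IsLocallyConstant (k₂ n) := fun n => (hp n).comp (q n)
  have hstep : ∀ n : ℕ, ∀ G : {G : Set X // IsClopen G ∧ A ⊆ G},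
      ∃ G' : {G : Set X // IsClopen G ∧ A ⊆ G}, G'.1 ⊆ G.1 ∧ G'.1 ⊆ H (n + 1) ∧
      (∀ a ∈ A, ∃ y ∈ G.1 \ G'.1, k₁ n y = k₁ n a) ∧
      (∀ a ∈ A, ∃ y ∈ G.1 \ G'.1, k₂ n y = k₂ n a) := by
    rintro n ⟨G, hG, hAG⟩
    obtain ⟨G', h1, h2⟩ := aux_step hz A hA hA' G (H (n + 1)) hG hAG (hH _) (hAH _)
      (k₁ n) (k₂ n) (hk₁ n) (hk₂ n)
    exact ⟨⟨G', h1⟩, h2⟩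
  choose nxt hn1 hn2 hn3 hn4 using hstep
  let G : ℕ → {G : Set X // IsClopen G ∧ A ⊆ G} :=
    fun n => Nat.rec ⟨H 0, hH 0, hAH 0⟩ (fun n g => nxt n g) n
  have G0 : (G 0).1 = H 0 := rfl
  have Gs : ∀ n, G (n + 1) = nxt n (G n) := fun n => rfl
  have hGH : ∀ n, (G n).1 ⊆ H n := by
    intro n
    cases n with
    | zero => exact subset_rfl
    | succ n => rw [Gs]; exact hn2 n _
  have hGanti : Antitone (fun n => (G n).1) :=
    antitone_nat_of_succ_le (fun n => by rw [Gs]; exact hn1 n _)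
  have hGcl : ∀ n, IsClopen (G n).1 := fun n => (G n).2.1
  have hAG : ∀ n, A ⊆ (G n).1 := fun n => (G n).2.2
  have hout : ∀ x, x ∉ A → ∃ n, x ∉ (G n).1 := by
    intro x hx
    by_contra hcon
    push Not at hcon
    apply hx
    rw [← hA.closure_eq, Metric.mem_closure_iff]
    intro r hr
    obtain ⟨n, hn⟩ := exists_nat_gt (δ / r)
    refine ⟨p n x, hGH n (hcon n), (hpd n x (hGH n (hcon n))).trans ?_⟩
    rw [div_lt_iff₀ hr] at hn
    rw [div_div, div_lt_iff₀ (by positivity)]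
    nlinarith
  let lev : X → ℕ := fun x => sInf {n | x ∉ (G n).1}
  have lev_notin : ∀ x, x ∉ A → x ∉ (G (lev x)).1 := fun x hx => Nat.sInf_mem (hout x hx)
  have lev_in : ∀ x n, n < lev x → x ∈ (G n).1 := by
    intro x n hn
    by_contra h
    exact Nat.notMem_of_lt_sInf hn h
  have lev_gt : ∀ x n, x ∉ A → x ∈ (G n).1 → n < lev x := by
    intro x n hx hn
    by_contra h
    exact lev_notin x hx (hGanti (not_lt.1 h) hn)
  have lev0 : ∀ x, (x ∉ A ∧ lev x = 0) ↔ x ∉ (G 0).1 := by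
    intro x
    constructor
    · rintro ⟨h1, h2⟩
      have := lev_notin x h1
      rwa [h2] at this
    · intro h
      have hx : x ∉ A := fun hx => h (hAG 0 hx)
      refine ⟨hx, ?_⟩
      by_contra h0
      exact h (lev_in x 0 (Nat.pos_of_ne_zero h0))
  have levs : ∀ x n, (x ∉ A ∧ lev x = n + 1) ↔ x ∈ (G n).1 \ (G (n + 1)).1 := by
    intro x n
    constructor
    · rintro ⟨h1, h2⟩
      refine ⟨lev_in x n (by omega), ?_⟩
      have := lev_notin x h1
      rwa [h2] at this
    · rintro ⟨h1, h2⟩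
      have hx : x ∉ A := fun hx => h2 (hAG (n + 1) hx)
      refine ⟨hx, ?_⟩
      have h3 := lev_gt x n hx h1
      have h4 : ¬ (n + 1 < lev x) := fun h => h2 (lev_in x _ h)
      omega
  let K : (ℕ → X → X) → X → ℕ × Option X := fun k x =>
    (lev x, Nat.casesOn (lev x) none (fun n => some (k n x)))
  have K0 : ∀ k, {x | x ∉ A ∧ K k x = (0, none)} = (G 0).1ᶜ := by
    intro k
    ext x
    rw [mem_compl_iff, ← lev0, mem_ofPred_eq, and_congr_right_iff]
    intro _
    constructor
    · intro h; exact congrArg Prod.fst h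
    · intro h; simp [K, h]
  have K0' : ∀ k s, {x | x ∉ A ∧ K k x = (0, some s)} = ∅ := by
    intro k s
    rw [eq_empty_iff_forall_notMem]
    rintro x ⟨_, h⟩
    have h1 : lev x = 0 := congrArg Prod.fst h
    simp [K, h1] at h
  have Ks' : ∀ k n, {x | x ∉ A ∧ K k x = (n + 1, none)} = ∅ := by
    intro k n
    rw [eq_empty_iff_forall_notMem]
    rintro x ⟨_, h⟩
    have h1 : lev x = n + 1 := congrArg Prod.fst h
    simp [K, h1] at h
  have Ks : ∀ k n s, {x | x ∉ A ∧ K k x = (n + 1, some s)} =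
      ((G n).1 \ (G (n + 1)).1) ∩ {x | k n x = s} := by
    intro k n s
    ext x
    rw [mem_inter_iff, ← levs, mem_ofPred_eq, mem_ofPred_eq, and_assoc, and_congr_right_iff]
    intro _
    constructor
    · intro h
      have h1 : lev x = n + 1 := congrArg Prod.fst h
      refine ⟨h1, ?_⟩
      simpa [K, h1] using h
    · rintro ⟨h1, h2⟩
      simp [K, h1, h2]
  have Kcl : ∀ k : ℕ → X → X, (∀ n, IsLocallyConstant (k n)) → ∀ s,
      IsClopen {x | x ∉ A ∧ K k x = s} := by
    intro k hk
    rintro ⟨_ | n, _ | s⟩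
    · rw [K0]; exact (hGcl 0).compl
    · rw [K0']; exact isClopen_empty
    · rw [Ks']; exact isClopen_empty
    · rw [Ks]; exact ((hGcl n).diff (hGcl (n + 1))).inter ((hk n).isClopen_fiber s)
  have ne12 : ∀ s, {x | x ∉ A ∧ K k₁ x = s}.Nonempty ↔ {x | x ∉ A ∧ K k₂ x = s}.Nonempty := by
    rintro ⟨_ | n, _ | s⟩
    · rw [K0, K0]
    · rw [K0', K0']
    · rw [Ks', Ks']
    · rw [Ks, Ks]
      constructor
      · rintro ⟨x, hx, rfl⟩
        have hpx : p n x ∈ A := hGH n hx.1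
        obtain ⟨y, hy, hyk⟩ := hn4 n (G n) (φ ⟨p n x, hpx⟩) (φ ⟨p n x, hpx⟩).2
        refine ⟨y, hy, ?_⟩
        change k₂ n y = k₁ n x
        rw [hyk]
        change q n (p n (φ ⟨p n x, hpx⟩)) = q n (φ' (p n x))
        rw [hqp n _ (φ ⟨p n x, hpx⟩).2, ← hφ']
      · rintro ⟨x, hx, rfl⟩
        have hpx : p n x ∈ A := hGH n hx.1
        obtain ⟨y, hy, hyk⟩ := hn3 n (G n) (φ.symm ⟨p n x, hpx⟩) (φ.symm ⟨p n x, hpx⟩).2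
        refine ⟨y, hy, ?_⟩
        change k₁ n y = k₂ n x
        rw [hyk]
        change q n (φ' (p n (φ.symm ⟨p n x, hpx⟩))) = q n (p n x)
        rw [hqp' n _ (φ.symm ⟨p n x, hpx⟩).2, hφ']
        simp
  have hex : ∀ s, ∃ e : {x | x ∉ A ∧ K k₁ x = s} ≃ₜ {x | x ∉ A ∧ K k₂ x = s},
      s.1 = 0 → ∀ x, (e x : X) = x := by
    intro s
    by_cases hs : s.1 = 0
    · have heq : {x | x ∉ A ∧ K k₁ x = s} = {x | x ∉ A ∧ K k₂ x = s} := by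
        obtain ⟨n, t⟩ := s
        obtain rfl : n = 0 := hs
        rcases t with _ | t
        · rw [K0, K0]
        · rw [K0', K0']
      exact ⟨Homeomorph.setCongr heq, fun _ x => rfl⟩
    · by_cases hne : {x | x ∉ A ∧ K k₁ x = s}.Nonempty
      · obtain ⟨e1⟩ := hh _ (Kcl k₁ hk₁ s) hne
        obtain ⟨e2⟩ := hh _ (Kcl k₂ hk₂ s) ((ne12 s).1 hne)
        exact ⟨e1.trans e2.symm, fun h => (hs h).elim⟩
      · have hne2 : ¬ {x | x ∉ A ∧ K k₂ x = s}.Nonempty := fun h => hne ((ne12 s).2 h)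
        rw [not_nonempty_iff_eq_empty] at hne hne2
        exact ⟨Homeomorph.setCongr (hne.trans hne2.symm), fun h => (hs h).elim⟩
  choose e he using hex
  obtain ⟨F, Fa, Fa', Fe, Fe', Fc, Fc'⟩ := aux_glue A φ (K k₁) (K k₂)
    (fun s => (Kcl k₁ hk₁ s).isOpen) (fun s => (Kcl k₂ hk₂ s).isOpen) e
  have FA : ∀ x, x ∉ A → F x ∉ A ∧ K k₂ (F x) = K k₁ x := by
    intro x hx
    rw [Fe x hx]
    exact (e (K k₁ x) ⟨x, hx, rfl⟩).2
  have Flev : ∀ x, x ∉ A → lev (F x) = lev x := fun x hx => congrArg Prod.fst (FA x hx).2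
  have FA' : ∀ x, x ∉ A → F.symm x ∉ A := by
    intro x hx h
    apply hx
    have := Fa ⟨_, h⟩
    simp only [Equiv.apply_symm_apply] at this
    rw [this]
    exact (φ _).2
  have key0 : ∀ n x, x ∉ A → lev x = n + 1 →
      ∃ a : A, dist x a < δ / (n + 1) ∧ dist (F x) (φ a) < δ / (n + 1) := by
    intro n x hx hl
    have hl' := Flev x hx
    rw [hl] at hl'
    have m1 := (levs x n).1 ⟨hx, hl⟩
    have m2 := (levs (F x) n).1 ⟨(FA x hx).1, hl'⟩
    have p1 : p n x ∈ A := hGH n m1.1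
    have p2 : p n (F x) ∈ A := hGH n m2.1
    have hk : q n (p n (F x)) = q n (φ' (p n x)) := by
      have := congrArg Prod.snd (FA x hx).2
      simp only [K, hl, hl'] at this
      exact Option.some.inj this
    have d1 := hpd n x p1
    have d2 := hpd n (F x) p2
    have d3 := hqd n (p n (F x))
    have d4 := hqd n (φ' (p n x))
    have h0 := hη n
    refine ⟨⟨p n x, p1⟩, by simp only; linarith, ?_⟩
    rw [← hφ']
    rw [hk] at d3
    have t1 := dist_triangle (F x) (p n (F x)) (φ' (p n x))
    have t2 := dist_triangle_right (p n (F x)) (φ' (p n x)) (q n (φ' (p n x)))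
    simp only
    linarith
  have key : ∀ n, ∀ x ∈ (G n).1, x ∉ A →
      ∃ a : A, dist x a < δ / (n + 1) ∧ dist (F x) (φ a) < δ / (n + 1) := by
    intro n x hx hxA
    have := lev_gt x n hxA hx
    obtain ⟨m, hm⟩ : ∃ m, lev x = m + 1 := ⟨lev x - 1, by omega⟩
    obtain ⟨a, h1, h2⟩ := key0 m x hxA hm
    have hle : δ / (m + 1) ≤ δ / (n + 1) := by
      have : (n : ℝ) ≤ m := by exact_mod_cast (by omega : n ≤ m)
      gcongr
    exact ⟨a, h1.trans_le hle, h2.trans_le hle⟩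
  have key' : ∀ n, ∀ x ∈ (G n).1, x ∉ A →
      ∃ a : A, dist x a < δ / (n + 1) ∧ dist (F.symm x) (φ.symm a) < δ / (n + 1) := by
    intro n x hx hxA
    have h1 := FA' x hxA
    have h2 := Flev _ h1
    rw [Equiv.apply_symm_apply] at h2
    have h3 : F.symm x ∈ (G n).1 := lev_in _ _ (h2 ▸ lev_gt x n hxA hx)
    obtain ⟨a, h4, h5⟩ := key n _ h3 h1
    rw [Equiv.apply_symm_apply] at h5
    exact ⟨φ a, h5, by simpa using h4⟩
  refine ⟨⟨F, ?_, ?_⟩, Fa, ?_⟩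
  · refine continuous_iff_continuousAt.2 fun x => ?_
    by_cases hx : x ∈ A
    · exact aux_cont A φ φ.continuous F Fa (fun n => (G n).1) (fun n => (hGcl n).isOpen) hAG δ hδ
        key ⟨x, hx⟩
    · exact Fc x hx
  · refine continuous_iff_continuousAt.2 fun x => ?_
    by_cases hx : x ∈ A
    · exact aux_cont A φ.symm φ.symm.continuous F.symm Fa' (fun n => (G n).1)
        (fun n => (hGcl n).isOpen) hAG δ hδ key' ⟨x, hx⟩
    · exact Fc' x hx
  · intro x
    change F x = x ∨ ∃ a : A, dist x a < δ ∧ dist (F x) (φ a) < δ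
    by_cases hx : x ∈ A
    · right
      refine ⟨⟨x, hx⟩, by simpa using hδ, ?_⟩
      rw [show F x = φ ⟨x, hx⟩ from Fa ⟨x, hx⟩]
      simpa using hδ
    · by_cases h0 : lev x = 0
      · left
        rw [Fe x hx]
        exact he _ h0 _
      · right
        have := key 0 x (lev_in x 0 (Nat.pos_of_ne_zero h0)) hx
        simpa using this

/-- two-sided version of the extension lemma, controlling both
`ρ₂(g, f)` and `ρ₁(g⁻¹, f⁻¹)`. -/
theorem stmt_3 {X₁ : Type u} {X₂ : Type v} [MetricSpace X₁] [MetricSpace X₂]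
    (hz₁ : StronglyZeroDim X₁) (hz₂ : StronglyZeroDim X₂)
    (hh₁ : HHomogeneous X₁) (hh₂ : HHomogeneous X₂)
    (A₁ : Set X₁) (A₂ : Set X₂)
    (hA₁ : IsClosed A₁) (hA₁' : IsNowhereDense A₁)
    (hA₂ : IsClosed A₂) (hA₂' : IsNowhereDense A₂)
    (g : X₁ ≃ₜ X₂) (hg : g '' A₁ = A₂)
    (f₀ : ↥A₁ ≃ₜ ↥A₂) (ε : ℝ) (hε : 0 < ε)
    (hclose : ∃ c₁ c₂ : ℝ, c₁ + c₂ < ε ∧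
      (∀ b : ↥A₂, dist (g.symm (b : X₂)) ((f₀.symm b : X₁)) ≤ c₁) ∧
      (∀ a : ↥A₁, dist (g (a : X₁)) ((f₀ a : X₂)) ≤ c₂)) :
    ∃ f : X₁ ≃ₜ X₂, (∀ a : ↥A₁, f (a : X₁) = (f₀ a : X₂)) ∧
      ∃ c₁ c₂ : ℝ, c₁ + c₂ < ε ∧
        (∀ y : X₂, dist (g.symm y) (f.symm y) ≤ c₁) ∧
        (∀ x : X₁, dist (g x) (f x) ≤ c₂) := by
  classical
  let Y := {z : X₁ × X₂ // z.2 = g z.1}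
  let T : X₁ ≃ₜ Y :=
    { toFun := fun x => ⟨(x, g x), rfl⟩
      invFun := fun z => z.1.1
      left_inv := fun x => rfl
      right_inv := by rintro ⟨⟨x, y⟩, h⟩; apply Subtype.ext; exact Prod.ext rfl h.symm
      continuous_toFun := by fun_prop
      continuous_invFun := by fun_prop }
  have hzY : StronglyZeroDim Y := by
    intro A B hA hB hAB
    obtain ⟨U, hU, h1, h2⟩ := hz₁ (T ⁻¹' A) (T ⁻¹' B) (hA.preimage T.continuous)
      (hB.preimage T.continuous) (hAB.preimage T)
    refine ⟨T.symm ⁻¹' U, hU.preimage T.symm.continuous, ?_, ?_⟩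
    · intro y hy
      exact h1 (by simpa using hy)
    · rw [Set.disjoint_left] at h2 ⊢
      intro y hy hy'
      exact h2 (a := T.symm y) (by simpa using hy) hy'
  have hhY : HHomogeneous Y := by
    intro U hU hne
    obtain ⟨y, hy⟩ := hne
    obtain ⟨e⟩ := hh₁ (T ⁻¹' U) (hU.preimage T.continuous) ⟨T.symm y, by simpa using hy⟩
    exact ⟨((T.sets (s := T ⁻¹' U) (t := U) rfl).symm.trans e).trans T⟩
  let A : Set Y := T.symm ⁻¹' A₁
  have hA : IsClosed A := hA₁.preimage T.symm.continuous
  have hA' : IsNowhereDense A := by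
    rw [hA.isNowhereDense_iff]
    rw [hA₁.isNowhereDense_iff] at hA₁'
    change interior (T.symm ⁻¹' A₁) = ∅
    rw [← T.symm.preimage_interior, hA₁', preimage_empty]
  let TA : A ≃ₜ A₁ := T.symm.sets (s := A) (t := A₁) rfl
  have hgA : A₁ = g ⁻¹' A₂ := by rw [← hg, preimage_image_eq _ g.injective]
  let gA : A₁ ≃ₜ A₂ := g.sets hgA
  let φ : A ≃ₜ A := (TA.trans (f₀.trans gA.symm)).trans TA.symm
  have hφ1 : ∀ a : A, g (T.symm (φ a)) = f₀ (TA a) := by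
    intro a
    have : gA (TA (φ a)) = f₀ (TA a) := by simp [φ]
    exact congrArg Subtype.val this
  obtain ⟨c₁, c₂, hc, hc1, hc2⟩ := hclose
  let δ := (ε - c₁ - c₂) / 8
  have hδ : 0 < δ := by simp only [δ]; linarith
  obtain ⟨F, Fa, Fd⟩ := aux_main hzY hhY A hA hA' φ δ hδ
  have d1 : ∀ y z : Y, dist (T.symm y) (T.symm z) ≤ dist y z := fun y z => le_max_left _ _
  have d2 : ∀ y z : Y, dist (g (T.symm y)) (g (T.symm z)) ≤ dist y z := by
    rintro ⟨⟨y, y'⟩, hy⟩ ⟨⟨z, z'⟩, hz⟩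
    simp only at hy hz
    subst hy hz
    exact le_max_right _ _
  let f : X₁ ≃ₜ X₂ := (T.trans (F.trans T.symm)).trans g
  refine ⟨f, ?_, ?_⟩
  · intro a
    have h1 := Fa (TA.symm a)
    have h2 := hφ1 (TA.symm a)
    rw [← h1] at h2
    rw [TA.apply_symm_apply] at h2
    exact h2
  · have main : ∀ w : Y, F w = w ∨ ∃ a : A, dist (T.symm w) (T.symm (F w)) ≤ c₁ + 2 * δ ∧
        dist (g (T.symm w)) (g (T.symm (F w))) ≤ c₂ + 2 * δ := by
      intro w
      rcases Fd w with h | ⟨a, h1, h2⟩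
      · exact Or.inl h
      · right
        have e1 := hc1 (f₀ (TA a))
        have e2 := hc2 (TA a)
        rw [← hφ1] at e1 e2
        simp only [Homeomorph.symm_apply_apply] at e1
        have q1 : dist (T.symm a) (T.symm (φ a)) ≤ c₁ := by rw [dist_comm]; exact e1
        have q2 : dist (g (T.symm a)) (g (T.symm (φ a))) ≤ c₂ := e2
        refine ⟨a, ?_, ?_⟩
        · have t := dist_triangle4 (T.symm w) (T.symm a) (T.symm (φ a)) (T.symm (F w))
          have u1 := d1 w a
          have u2 := d1 (φ a) (F w)
          rw [dist_comm (φ a : Y)] at u2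
          linarith
        · have t := dist_triangle4 (g (T.symm w)) (g (T.symm a)) (g (T.symm (φ a)))
            (g (T.symm (F w)))
          have u1 := d2 w a
          have u2 := d2 (φ a) (F w)
          rw [dist_comm (φ a : Y)] at u2
          linarith
    have hbound : ∃ b₁ b₂ : ℝ, b₁ + b₂ < ε ∧ ∀ w : Y, dist (T.symm w) (T.symm (F w)) ≤ b₁ ∧
        dist (g (T.symm w)) (g (T.symm (F w))) ≤ b₂ := by
      by_cases hne : Nonempty A
      · obtain ⟨a⟩ := hne
        have n1 : 0 ≤ c₁ := dist_nonneg.trans (hc1 (f₀ (TA a)))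
        have n2 : 0 ≤ c₂ := dist_nonneg.trans (hc2 (TA a))
        refine ⟨c₁ + 2 * δ, c₂ + 2 * δ, by simp only [δ]; linarith, fun w => ?_⟩
        rcases main w with h | ⟨_, h⟩
        · rw [h, dist_self, dist_self]
          constructor <;> linarith
        · exact h
      · refine ⟨0, 0, by simpa using hε, fun w => ?_⟩
        rcases main w with h | ⟨a, _⟩
        · rw [h, dist_self, dist_self]
          exact ⟨le_rfl, le_rfl⟩
        · exact (hne ⟨a⟩).elim
    obtain ⟨b₁, b₂, hb, hw⟩ := hbound
    refine ⟨b₁, b₂, hb, fun y => ?_, fun x => ?_⟩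
    · have := (hw (T (f.symm y))).1
      have hfy : T.symm (F (T (f.symm y))) = g.symm y := by
        rw [← g.injective.eq_iff, g.apply_symm_apply]
        exact f.apply_symm_apply y
      rw [hfy, T.symm_apply_apply, dist_comm] at this
      exact this
    · have := (hw (T x)).2
      rw [T.symm_apply_apply] at this
      exact this
end

section
/- Let k be an infinite cardinal, let F be an F_σ-subset of the space B*(k), and let A ⊆ F. Suppose A is a co-Souslin set in B*(k) and A does not belong to σLW(<k) + 𝒢_δσ. Then there exists a closed subset M ⊆ B*(k) such that: (1) A ∩ M is a nowhere dense closed subset of A; (2) A ∩ M is nowhere σLW(<k) + 𝒢_δσ and of first category; (3) M ⊆ F and M is homeomorphic to B*(k). -/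
open Topology Set Filter

universe u v

section
set_option linter.unusedSectionVars false
set_option linter.unusedVariables false

namespace HF
open PiNat

section weight

theorem wlt_of_inducing {X Y : Type u} [TopologicalSpace X] [TopologicalSpace Y] {k : Cardinal.{u}}
    {f : X → Y} (hf : IsInducing f) (h : WeightLT Y k) : WeightLT X k := by
  obtain ⟨B, hB, hk⟩ := h
  exact ⟨_, hB.isInducing hf, lt_of_le_of_lt Cardinal.mk_image_le hk⟩

theorem wlt_mono {X : Type u} [TopologicalSpace X] {k : Cardinal.{u}} {s t : Set X} (hst : s ⊆ t)
    (h : WeightLT ↥t k) : WeightLT ↥s k :=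
  wlt_of_inducing (IsEmbedding.inclusion hst).isInducing h

theorem wlt_image {X Y : Type u} [TopologicalSpace X] [TopologicalSpace Y] {k : Cardinal.{u}}
    {f : X → Y} (hf : IsEmbedding f) (s : Set X) (h : WeightLT ↥s k) : WeightLT ↥(f '' s) k := by
  have := (hf.comp (IsEmbedding.subtypeVal (p := (· ∈ s))))
  have e := this.toHomeomorph
  have h2 : WeightLT ↥(range (f ∘ (Subtype.val : s → X))) k :=
    wlt_of_inducing e.symm.isInducing h
  have h3 : f '' s = range (f ∘ (Subtype.val : s → X)) := by
    rw [range_comp, Subtype.range_coe]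
  rw [h3]; exact h2

end weight

variable {T : Type u} [TopologicalSpace T] [DiscreteTopology T]

theorem cyl_eq {x y : ℕ → T} {n m : ℕ} (h : y ∈ cylinder x n) (hm : m ≤ n) :
    cylinder y m = cylinder x m :=
  mem_cylinder_iff_eq.1 (cylinder_anti x hm h)

theorem cyl_nhds (x : ℕ → T) (n : ℕ) : cylinder x n ∈ 𝓝 x :=
  (isOpen_cylinder _ x n).mem_nhds (self_mem_cylinder x n)

theorem cyl_sub {x : ℕ → T} {O : Set (ℕ → T)} (h : O ∈ 𝓝 x) : ∃ n, cylinder x n ⊆ O := by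
  obtain ⟨s, ⟨y, n, rfl⟩, hx, hs⟩ := (isTopologicalBasis_cylinders (fun _ => T)).mem_nhds_iff.1 h
  exact ⟨n, by rw [cyl_eq hx le_rfl]; exact hs⟩

theorem cyl_clopen (x : ℕ → T) (n : ℕ) : IsClosed (cylinder x n) := by
  rw [cylinder_eq_pi]
  exact isClosed_set_pi fun i _ => isClosed_discrete _

/-- locally of weight `< k`, set version -/
def LWs (k : Cardinal.{u}) (Z : Set (ℕ → T)) : Prop :=
  ∀ x ∈ Z, ∃ n, WeightLT ↥(Z ∩ cylinder x n) k

theorem LWs_mono {k : Cardinal.{u}} {Z Z' : Set (ℕ → T)} (h : Z' ⊆ Z) (hZ : LWs k Z) :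
    LWs k Z' := fun x hx => by
  obtain ⟨n, hn⟩ := hZ x (h hx)
  exact ⟨n, wlt_mono (inter_subset_inter_left _ h) hn⟩

theorem LWs_of_emb {Y : Type u} [TopologicalSpace Y] {k : Cardinal.{u}} {i : Y → ℕ → T}
    (hi : IsEmbedding i) (h : LocallyWeightLT Y k) : LWs k (range i) := by
  rintro _ ⟨y, rfl⟩
  obtain ⟨s, hs, hw⟩ := h y
  rw [hi.nhds_eq_comap] at hs
  obtain ⟨O, hO, hOs⟩ := hs
  obtain ⟨n, hn⟩ := cyl_sub hO
  refine ⟨n, wlt_mono ?_ (wlt_image hi s hw)⟩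
  rintro _ ⟨⟨z, rfl⟩, hz⟩
  exact ⟨z, hOs (hn hz), rfl⟩

theorem LW_of_LWs {Y : Type u} [TopologicalSpace Y] {k : Cardinal.{u}} {i : Y → ℕ → T}
    (hi : IsEmbedding i) (h : LWs k (range i)) : LocallyWeightLT Y k := by
  intro y
  obtain ⟨n, hn⟩ := h (i y) ⟨y, rfl⟩
  refine ⟨i ⁻¹' cylinder (i y) n, hi.continuous.continuousAt (cyl_nhds _ _), ?_⟩
  let g : ↥(i ⁻¹' cylinder (i y) n) → ↥(range i ∩ cylinder (i y) n) :=
    fun z => ⟨i z.1, ⟨z.1, rfl⟩, z.2⟩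
  have hg : IsInducing g := by
    have : IsInducing (Subtype.val ∘ g) := (hi.comp IsEmbedding.subtypeVal).isInducing
    exact IsInducing.of_comp (by
      refine Continuous.subtype_mk ?_ _
      exact hi.continuous.comp continuous_subtype_val) continuous_subtype_val this
  exact wlt_of_inducing hg hn

/-- `σLW(<k) + G_δσ`, set version -/
def Pz (k : Cardinal.{u}) (Z : Set (ℕ → T)) : Prop :=
  ∃ G S : ℕ → Set (ℕ → T), (∀ n, IsGδ (G n)) ∧ (∀ n, G n ⊆ Z) ∧ (∀ n, LWs k (S n)) ∧
    Z ⊆ (⋃ n, G n) ∪ ⋃ n, S n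

theorem Pz_inter {k : Cardinal.{u}} {Z H : Set (ℕ → T)} (hZ : Pz k Z) (hH : IsGδ H) :
    Pz k (Z ∩ H) := by
  obtain ⟨G, S, hG, hGZ, hS, hc⟩ := hZ
  refine ⟨fun n => G n ∩ H, S, fun n => (hG n).inter hH,
    fun n => inter_subset_inter_left _ (hGZ n), hS, ?_⟩
  rintro x ⟨hx, hxH⟩
  rcases hc hx with h | h
  · left
    obtain ⟨n, hn⟩ := mem_iUnion.1 h
    exact mem_iUnion.2 ⟨n, hn, hxH⟩
  · exact Or.inr h

theorem Pz_iUnion {k : Cardinal.{u}} {Z : ℕ → Set (ℕ → T)} (hZ : ∀ n, Pz k (Z n)) :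
    Pz k (⋃ n, Z n) := by
  choose G S hG hGZ hS hc using hZ
  refine ⟨fun n => G n.unpair.1 n.unpair.2, fun n => S n.unpair.1 n.unpair.2, fun n => hG _ _,
    fun n => (hGZ _ _).trans (subset_iUnion Z _), fun n => hS _ _, ?_⟩
  intro x hx
  obtain ⟨m, hm⟩ := mem_iUnion.1 hx
  rcases hc m hm with h | h
  · left
    obtain ⟨n, hn⟩ := mem_iUnion.1 h
    exact mem_iUnion.2 ⟨Nat.pair m n, by simpa using hn⟩
  · right
    obtain ⟨n, hn⟩ := mem_iUnion.1 h
    exact mem_iUnion.2 ⟨Nat.pair m n, by simpa using hn⟩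

theorem Pz_Gδ {k : Cardinal.{u}} {Z : Set (ℕ → T)} (hZ : IsGδ Z) : Pz k Z :=
  ⟨fun _ => Z, fun _ => ∅, fun _ => hZ, fun _ => Subset.rfl, fun _ x hx => hx.elim,
    fun x hx => Or.inl (mem_iUnion.2 ⟨0, hx⟩)⟩

theorem Pz_LWs {k : Cardinal.{u}} {Z : Set (ℕ → T)} (hZ : LWs k Z) : Pz k Z :=
  ⟨fun _ => ∅, fun _ => Z, fun _ => IsGδ.empty, fun _ => empty_subset _, fun _ => hZ,
    fun x hx => Or.inr (mem_iUnion.2 ⟨0, hx⟩)⟩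

theorem Pz_iUnion' {ι : Type*} [Countable ι] {k : Cardinal.{u}} {Z : ι → Set (ℕ → T)}
    (hZ : ∀ n, Pz k (Z n)) : Pz k (⋃ n, Z n) := by
  rcases isEmpty_or_nonempty ι with h | h
  · rw [iUnion_of_empty]; exact Pz_Gδ IsGδ.empty
  · obtain ⟨f, hf⟩ := exists_surjective_nat ι
    rw [← hf.iUnion_comp]
    exact Pz_iUnion fun n => hZ _

theorem Pz_union {k : Cardinal.{u}} {Z Z' : Set (ℕ → T)} (h : Pz k Z) (h' : Pz k Z') :
    Pz k (Z ∪ Z') := by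
  rw [union_eq_iUnion]
  exact Pz_iUnion' fun b => by cases b <;> assumption

/-! ### Maximal cylinders and gluing -/

/-- maximal cylinder with property `Q` around `x` -/
noncomputable def mc (Q : Set (ℕ → T) → Prop) (x : ℕ → T) : Set (ℕ → T) :=
  cylinder x (sInf {n | Q (cylinder x n)})

/-- points having a cylinder with property `Q` -/
def uc (Q : Set (ℕ → T) → Prop) : Set (ℕ → T) := {x | ∃ n, Q (cylinder x n)}

theorem mc_spec {Q : Set (ℕ → T) → Prop} {x : ℕ → T} (h : x ∈ uc Q) : Q (mc Q x) :=
  Nat.sInf_mem (s := {n | Q (cylinder x n)}) h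

theorem mc_self (Q : Set (ℕ → T) → Prop) (x : ℕ → T) : x ∈ mc Q x := self_mem_cylinder _ _

theorem mc_open (Q : Set (ℕ → T) → Prop) (x : ℕ → T) : IsOpen (mc Q x) := isOpen_cylinder _ _ _

theorem mc_closed (Q : Set (ℕ → T) → Prop) (x : ℕ → T) : IsClosed (mc Q x) := cyl_clopen _ _

theorem mc_uc {Q : Set (ℕ → T) → Prop} {x y : ℕ → T} (h : x ∈ uc Q) (hy : y ∈ mc Q x) :
    y ∈ uc Q := ⟨sInf {n | Q (cylinder x n)}, by
      rw [cyl_eq hy le_rfl]; exact mc_spec h⟩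

theorem mc_eq {Q : Set (ℕ → T) → Prop} {x y : ℕ → T} (h : x ∈ uc Q) (hy : y ∈ mc Q x) :
    mc Q y = mc Q x := by
  have key : sInf {n | Q (cylinder y n)} = sInf {n | Q (cylinder x n)} := by
    apply le_antisymm
    · apply Nat.sInf_le
      show Q _
      rw [cyl_eq hy le_rfl]; exact mc_spec h
    · by_contra! hlt
      have h1 := mc_spec (mc_uc h hy)
      unfold mc at h1
      rw [cyl_eq hy hlt.le] at h1
      exact absurd (Nat.sInf_le (s := {n | Q (cylinder x n)}) h1) (not_le.2 hlt)
  unfold mc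
  rw [key]
  exact cyl_eq hy le_rfl

theorem uc_open (Q : Set (ℕ → T) → Prop) : IsOpen (uc Q) := by
  rw [isOpen_iff_mem_nhds]
  intro x hx
  exact mem_of_superset ((mc_open Q x).mem_nhds (mc_self Q x)) fun y hy => mc_uc hx hy

theorem glue_open {Q : Set (ℕ → T) → Prop} {O : Set (ℕ → T) → Set (ℕ → T)}
    (hO : ∀ V, Q V → IsOpen (O V)) : IsOpen {x | x ∈ uc Q ∧ x ∈ O (mc Q x)} := by
  rw [isOpen_iff_mem_nhds]
  rintro x ⟨hx, hxO⟩
  filter_upwards [(mc_open Q x).mem_nhds (mc_self Q x), (hO _ (mc_spec hx)).mem_nhds hxO]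
    with y hy hyO
  exact ⟨mc_uc hx hy, by rw [mc_eq hx hy]; exact hyO⟩

theorem glue_Gδ {Q : Set (ℕ → T) → Prop} {O : Set (ℕ → T) → Set (ℕ → T)}
    (hO : ∀ V, Q V → IsGδ (O V)) : IsGδ {x | x ∈ uc Q ∧ x ∈ O (mc Q x)} := by
  have : ∀ V, ∃ f : ℕ → Set (ℕ → T), Q V → (∀ n, IsOpen (f n)) ∧ O V = ⋂ n, f n := by
    intro V
    by_cases hV : Q V
    · obtain ⟨f, hf, he⟩ := isGδ_iff_eq_iInter_nat.1 (hO V hV)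
      exact ⟨f, fun _ => ⟨hf, he⟩⟩
    · exact ⟨fun _ => ∅, fun h => absurd h hV⟩
  choose f hf using this
  have he : {x | x ∈ uc Q ∧ x ∈ O (mc Q x)} = ⋂ n, {x | x ∈ uc Q ∧ x ∈ f (mc Q x) n} := by
    ext x
    simp only [mem_ofPred_eq, mem_iInter]
    constructor
    · rintro ⟨h, h2⟩ n
      rw [(hf _ (mc_spec h)).2] at h2
      exact ⟨h, mem_iInter.1 h2 n⟩
    · intro h
      refine ⟨(h 0).1, ?_⟩
      rw [(hf _ (mc_spec (h 0).1)).2]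
      exact mem_iInter.2 fun n => (h n).2
  rw [he]
  exact IsGδ.iInter_of_isOpen fun n => glue_open (O := fun V => f V n) fun V hV => (hf V hV).1 n

theorem glue_Pz {k : Cardinal.{u}} {Q : Set (ℕ → T) → Prop} {D : Set (ℕ → T) → Set (ℕ → T)}
    (hD : ∀ V, Q V → Pz k (D V)) : Pz k {x | x ∈ uc Q ∧ x ∈ D (mc Q x)} := by
  have : ∀ V, ∃ G S : ℕ → Set (ℕ → T), Q V → (∀ n, IsGδ (G n)) ∧ (∀ n, G n ⊆ D V) ∧
      (∀ n, LWs k (S n)) ∧ D V ⊆ (⋃ n, G n) ∪ ⋃ n, S n := by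
    intro V
    by_cases hV : Q V
    · obtain ⟨G, S, h⟩ := hD V hV
      exact ⟨G, S, fun _ => h⟩
    · exact ⟨fun _ => ∅, fun _ => ∅, fun h => absurd h hV⟩
  choose G S h using this
  refine ⟨fun n => {x | x ∈ uc Q ∧ x ∈ G (mc Q x) n}, fun n => {x | x ∈ uc Q ∧ x ∈ S (mc Q x) n},
    fun n => glue_Gδ (O := fun V => G V n) fun V hV => (h V hV).1 n, ?_, ?_, ?_⟩
  · rintro n x ⟨hx, hx2⟩
    exact ⟨hx, (h _ (mc_spec hx)).2.1 n hx2⟩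
  · rintro n x ⟨hx, hx2⟩
    obtain ⟨m, hm⟩ := (h _ (mc_spec hx)).2.2.1 n x hx2
    refine ⟨max m (sInf {n | Q (cylinder x n)}), wlt_mono ?_ hm⟩
    rintro y ⟨⟨hy, hyS⟩, hyc⟩
    have h1 : y ∈ mc Q x := cylinder_anti x (le_max_right _ _) hyc
    rw [mc_eq hx h1] at hyS
    exact ⟨hyS, cylinder_anti x (le_max_left _ _) hyc⟩
  · rintro x ⟨hx, hx2⟩
    rcases (h _ (mc_spec hx)).2.2.2 hx2 with h' | h'
    · left
      obtain ⟨n, hn⟩ := mem_iUnion.1 h'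
      exact mem_iUnion.2 ⟨n, hx, hn⟩
    · right
      obtain ⟨n, hn⟩ := mem_iUnion.1 h'
      exact mem_iUnion.2 ⟨n, hx, hn⟩

end HF

end


section
set_option linter.unusedSectionVars false
set_option linter.unusedVariables false

namespace HF
open PiNat
variable {T : Type u} [TopologicalSpace T] [DiscreteTopology T]

theorem closed_Gδ {Z : Set (ℕ → T)} (h : IsClosed Z) : IsGδ Z := by
  let _ := PiNat.metricSpace (E := fun _ : ℕ => T)
  exact h.isGδ

/-- the smallness notion: `A ∩ Z` is, up to a `Pz` part, separated from `S` by a `G_δ`. -/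
def K (k : Cardinal.{u}) (A Z S : Set (ℕ → T)) : Prop :=
  ∃ D H : Set (ℕ → T), D ⊆ A ∧ Pz k D ∧ IsGδ H ∧ Disjoint H S ∧ A ∩ Z ⊆ D ∪ H

variable {k : Cardinal.{u}} {A Z Z' S S' : Set (ℕ → T)}

theorem K_mono (h : K k A Z S) (hZ : A ∩ Z' ⊆ Z) (hS : S' ⊆ S) : K k A Z' S' := by
  obtain ⟨D, H, h1, h2, h3, h4, h5⟩ := h
  exact ⟨D, H, h1, h2, h3, h4.mono_right hS, fun x hx => h5 ⟨hx.1, hZ hx⟩⟩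

theorem K_iInter {Sn : ℕ → Set (ℕ → T)} (h : ∀ n, K k A Z (Sn n)) : K k A Z (⋃ n, Sn n) := by
  choose D H h1 h2 h3 h4 h5 using h
  refine ⟨⋃ n, D n, ⋂ n, H n, iUnion_subset h1, Pz_iUnion h2, IsGδ.iInter h3, ?_, ?_⟩
  · rw [disjoint_iUnion_right]
    exact fun n => (h4 n).mono_left (iInter_subset _ n)
  · intro x hx
    by_cases hD : ∃ n, x ∈ D n
    · exact Or.inl (mem_iUnion.2 hD)
    · right
      push Not at hD
      exact mem_iInter.2 fun n => (h5 n hx).resolve_left (hD n)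

theorem K_union (h : K k A Z S) (h' : K k A Z' S) : K k A (Z ∪ Z') S := by
  obtain ⟨D, H, h1, h2, h3, h4, h5⟩ := h
  obtain ⟨D', H', h1', h2', h3', h4', h5'⟩ := h'
  refine ⟨D ∪ D', H ∪ H', union_subset h1 h1', Pz_union h2 h2', h3.union h3', 
    disjoint_union_left.2 ⟨h4, h4'⟩, ?_⟩
  rintro x ⟨hA, hx | hx⟩
  · rcases h5 ⟨hA, hx⟩ with h | h
    · exact Or.inl (Or.inl h)
    · exact Or.inr (Or.inl h)
  · rcases h5' ⟨hA, hx⟩ with h | h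
    · exact Or.inl (Or.inr h)
    · exact Or.inr (Or.inr h)

theorem K_of_Gδ (h : IsGδ Z) (hd : Disjoint Z S) : K k A Z S :=
  ⟨∅, Z, empty_subset _, Pz_Gδ IsGδ.empty, h, hd, fun x hx => Or.inr hx.2⟩

theorem K_of_Pz {D : Set (ℕ → T)} (hD : D ⊆ A) (h : Pz k D) (hZ : A ∩ Z ⊆ D) : K k A Z S :=
  ⟨D, ∅, hD, h, IsGδ.empty, empty_disjoint _, fun x hx => Or.inl (hZ hx)⟩

/-- for `S = Aᶜ`, smallness is just being contained in a `Pz` subset of `A` -/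
theorem K_compl : K k A Z Aᶜ ↔ ∃ D ⊆ A, Pz k D ∧ A ∩ Z ⊆ D := by
  constructor
  · rintro ⟨D, H, h1, h2, h3, h4, h5⟩
    exact ⟨D ∪ H, union_subset h1 (disjoint_compl_right_iff_subset.1 h4),
      Pz_union h2 (Pz_Gδ h3), h5⟩
  · rintro ⟨D, h1, h2, h3⟩
    exact K_of_Pz h1 h2 h3

theorem K_compl_iUnion {ι : Type*} [Countable ι] {Zn : ι → Set (ℕ → T)}
    (h : ∀ n, K k A (Zn n) Aᶜ) : K k A (⋃ n, Zn n) Aᶜ := by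
  simp only [K_compl] at h ⊢
  choose D h1 h2 h3 using h
  refine ⟨⋃ n, D n, iUnion_subset h1, Pz_iUnion' h2, ?_⟩
  rw [inter_iUnion]
  exact iUnion_mono h3

theorem K_compl_iff (hZ : IsGδ Z) : K k A Z Aᶜ ↔ Pz k (A ∩ Z) := by
  rw [K_compl]
  constructor
  · rintro ⟨D, h1, h2, h3⟩
    have : A ∩ Z = D ∩ Z := by
      ext x; exact ⟨fun h => ⟨h3 h, h.2⟩, fun h => ⟨h1 h.1, h.2⟩⟩
    rw [this]; exact Pz_inter h2 hZ
  · intro h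
    exact ⟨_, inter_subset_left, h, Subset.rfl⟩

/-- the open set where `Z` is locally small -/
def us (k : Cardinal.{u}) (A Z S : Set (ℕ → T)) : Set (ℕ → T) := uc fun V => K k A (Z ∩ V) S

/-- kernel -/
def ker (k : Cardinal.{u}) (A Z S : Set (ℕ → T)) : Set (ℕ → T) := Z \ us k A Z S

theorem K_us : K k A (Z ∩ us k A Z S) S := by
  let Q : Set (ℕ → T) → Prop := fun V => K k A (Z ∩ V) S
  have : ∀ V, ∃ D H : Set (ℕ → T), Q V → 
      D ⊆ A ∧ Pz k D ∧ IsGδ H ∧ Disjoint H S ∧ A ∩ (Z ∩ V) ⊆ D ∪ H := by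
    intro V
    by_cases hV : Q V
    · obtain ⟨D, H, h⟩ := hV
      exact ⟨D, H, fun _ => h⟩
    · exact ⟨∅, ∅, fun h => absurd h hV⟩
  choose D H h using this
  refine ⟨{x | x ∈ uc Q ∧ x ∈ D (mc Q x)}, {x | x ∈ uc Q ∧ x ∈ H (mc Q x)}, ?_,
    glue_Pz fun V hV => (h V hV).2.1, glue_Gδ fun V hV => (h V hV).2.2.1, ?_, ?_⟩
  · rintro x ⟨hx, hx2⟩
    exact (h _ (mc_spec hx)).1 hx2
  · rw [Set.disjoint_left]
    rintro x ⟨hx, hx2⟩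
    exact Set.disjoint_left.1 (h _ (mc_spec hx)).2.2.2.1 hx2
  · rintro x ⟨hA, hZ, hx⟩
    rcases (h _ (mc_spec hx)).2.2.2.2 ⟨hA, hZ, mc_self Q x⟩ with h' | h'
    · exact Or.inl ⟨hx, h'⟩
    · exact Or.inr ⟨hx, h'⟩

/-- nowhere small -/
def NK (k : Cardinal.{u}) (A Z S : Set (ℕ → T)) : Prop :=
  ∀ x ∈ Z, ∀ n, ¬ K k A (Z ∩ cylinder x n) S

theorem NK_mono (h : NK k A Z S) (hS : S ⊆ S') : NK k A Z S' := fun x hx n hK =>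
  h x hx n (K_mono hK (fun _ h => h.2) hS)

theorem ker_NK : NK k A (ker k A Z S) S := by
  rintro x ⟨hx, hxu⟩ n hK
  refine hxu ⟨n, ?_⟩
  refine K_mono (K_union (K_us (k := k) (A := A) (Z := Z) (S := S)) hK) ?_ Subset.rfl
  rintro y ⟨hA, hy, hyc⟩
  by_cases h : y ∈ us k A Z S
  · exact Or.inl ⟨hy, h⟩
  · exact Or.inr ⟨⟨hy, h⟩, hyc⟩

theorem ker_closed (hZ : IsClosed Z) : IsClosed (ker k A Z S) := by
  exact hZ.sdiff (uc_open _)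

theorem ker_nonempty (h : ¬ K k A Z S) : (ker k A Z S).Nonempty := by
  by_contra hne
  rw [not_nonempty_iff_eq_empty] at hne
  refine h (K_mono (K_us (k := k) (A := A) (Z := Z) (S := S)) ?_ Subset.rfl)
  intro x hx
  by_contra hh
  have : x ∈ ker k A Z S := ⟨hx.2, fun h' => hh ⟨hx.2, h'⟩⟩
  rw [hne] at this
  exact this

theorem ker_sub : ker k A Z S ⊆ Z := sdiff_subset

theorem NK_ker_eq (h : NK k A Z S) : ker k A Z S = Z := by
  refine Subset.antisymm ker_sub fun x hx => ⟨hx, ?_⟩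
  rintro ⟨n, hn⟩
  exact h x hx n hn

/-- `S` is dense in a nowhere small closed set -/
theorem NK_sub {F : Set (ℕ → T)} (hZ : IsClosed Z) (h : NK k A Z S) (hF : IsClosed F) 
    (hS : S ⊆ F) : Z ⊆ F := by
  intro x hx
  by_contra hxF
  obtain ⟨n, hn⟩ := cyl_sub (hF.isOpen_compl.mem_nhds hxF)
  refine h x hx n (K_of_Gδ (closed_Gδ (hZ.inter (cyl_clopen x n))) ?_)
  rw [Set.disjoint_left]
  rintro y ⟨-, hy⟩ hyS
  exact hn hy (hS hyS)

/-- `A` is dense in a nowhere small set -/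
theorem NK_dense (h : NK k A Z S) {x : ℕ → T} (hx : x ∈ Z) (n : ℕ) :
    (A ∩ (Z ∩ cylinder x n)).Nonempty := by
  by_contra hne
  rw [not_nonempty_iff_eq_empty] at hne
  exact h x hx n (K_of_Pz (empty_subset _) (Pz_Gδ IsGδ.empty) hne.subset)

/-! ### Souslin schemes -/

/-- initial segment -/
def pre (t : ℕ → ℕ) (n : ℕ) : List ℕ := List.ofFn fun i : Fin n => t i

theorem pre_succ (t : ℕ → ℕ) (n : ℕ) : pre t (n + 1) = pre t n ++ [t n] := by
  unfold pre
  rw [List.ofFn_succ_last]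
  simp

theorem pre_length (t : ℕ → ℕ) (n : ℕ) : (pre t n).length = n := by simp [pre]

/-- part of the Souslin set through `s` -/
def Sp (F : List ℕ → Set (ℕ → T)) (s : List ℕ) : Set (ℕ → T) :=
  {x | ∃ t : ℕ → ℕ, pre t s.length = s ∧ ∀ n, x ∈ F (pre t n)}

theorem Sp_sub (F : List ℕ → Set (ℕ → T)) (s : List ℕ) : Sp F s ⊆ F s := by
  rintro x ⟨t, ht, h⟩
  rw [← ht]; exact h _

theorem Sp_split (F : List ℕ → Set (ℕ → T)) (s : List ℕ) : 
    Sp F s ⊆ ⋃ n, Sp F (s ++ [n]) := by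
  rintro x ⟨t, ht, h⟩
  refine mem_iUnion.2 ⟨t s.length, t, ?_, h⟩
  rw [List.length_append, List.length_singleton, pre_succ, ht]

theorem Sp_sub_nil (F : List ℕ → Set (ℕ → T)) (s : List ℕ) : Sp F s ⊆ Sp F [] := by
  rintro x ⟨t, ht, h⟩
  exact ⟨t, by simp [pre], h⟩

/-- follow a branch -/
theorem Sp_branch (F : List ℕ → Set (ℕ → T)) {x : ℕ → T} (l : ℕ → List ℕ) (h0 : l 0 = [])
    (hs : ∀ n, ∃ m, l (n + 1) = l n ++ [m]) (hx : ∀ n, x ∈ F (l n)) : x ∈ Sp F [] := by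
  choose t ht using hs
  have : ∀ n, pre t n = l n := by
    intro n
    induction n with
    | zero => simp [pre, h0]
    | succ n ih => rw [pre_succ, ih, ht]
  exact ⟨t, by simp [pre], fun n => by rw [this]; exact hx n⟩

/-- `E` is nowhere dense in `C` -/
def ND (E C : Set (ℕ → T)) : Prop := ∀ x ∈ C, ∀ n, ∃ y ∈ C ∩ cylinder x n, y ∉ E

/-- Key lemma. -/
theorem key_nd {C : Set (ℕ → T)} {F : List ℕ → Set (ℕ → T)} (hF : ∀ l, IsClosed (F l))
    (hAS : Aᶜ = Sp F []) (hC : IsClosed C) (hne : C.Nonempty) (hNK : NK k A C Aᶜ) :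
    ∃ E ⊆ C, IsClosed E ∧ ND E C ∧ ¬ K k A E Aᶜ := by
  by_contra! hcon
  have hSA : ∀ s, Sp F s ⊆ Aᶜ := fun s => by rw [hAS]; exact Sp_sub_nil F s
  let R : List ℕ → Set (ℕ → T) := fun s => ker k A C (Sp F s) ∩ ⋂ n, us k A C (Sp F (s ++ [n]))
  have hRG : ∀ s, IsGδ (R s) := fun s => (closed_Gδ (ker_closed hC)).inter
    (IsGδ.iInter_of_isOpen fun n => uc_open _)
  -- each R s is small
  have hR : ∀ s, K k A (R s) Aᶜ := by
    intro s
    have h1 : K k A (R s) (Sp F s) := by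
      refine K_mono (K_iInter (Sn := fun n => Sp F (s ++ [n])) (Z := R s) fun n => ?_) 
        (fun x hx => hx.2) (Sp_split F s)
      refine K_mono (K_us (Z := C)) ?_ Subset.rfl
      rintro x ⟨-, hx1, hx2⟩
      exact ⟨ker_sub hx1, mem_iInter.1 hx2 n⟩
    obtain ⟨D, H, hDA, hD, hH, hHS, hc⟩ := h1
    -- the G_δ part is nowhere dense
    have hH' : IsGδ (H ∩ R s) := hH.inter (hRG s)
    have hsub : closure (H ∩ R s) ⊆ ker k A C (Sp F s) :=
      closure_minimal (fun x hx => hx.2.1) (ker_closed hC)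
    have hnd : ND (closure (H ∩ R s)) C := by
      by_contra hn
      unfold ND at hn
      push Not at hn
      obtain ⟨x, hx, n, hn⟩ := hn
      have hxk := hsub (hn x ⟨hx, self_mem_cylinder x n⟩)
      refine hxk.2 ⟨n, ?_⟩
      obtain ⟨O, hO, hOe⟩ := isGδ_iff_eq_iInter_nat.1 hH'
      have hE : ∀ m, K k A (C ∩ cylinder x n ∩ (O m)ᶜ) Aᶜ := by
        intro m
        refine hcon _ (fun y hy => hy.1.1) ((hC.inter (cyl_clopen x n)).inter 
          (hO m).isClosed_compl) ?_
        intro z hz j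
        by_cases hzx : z ∈ cylinder x n
        · have := hn z ⟨hz, hzx⟩
          rw [mem_closure_iff] at this
          obtain ⟨y, hy1, hy2⟩ := this (cylinder z j) (isOpen_cylinder _ z j) 
            (self_mem_cylinder z j)
          refine ⟨y, ⟨ker_sub hy2.2.1, hy1⟩, fun hy => hy.2 ?_⟩
          rw [hOe] at hy2
          exact mem_iInter.1 hy2 m
        · exact ⟨z, ⟨hz, self_mem_cylinder z j⟩, fun h => hzx h.1.2⟩
      obtain ⟨D', hD'A, hD', hc'⟩ := K_compl.1 (K_compl_iUnion hE)
      refine ⟨D', H ∩ R s, hD'A, hD', hH', hHS.mono_left inter_subset_left, ?_⟩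
      rintro y ⟨hyA, hy⟩
      by_cases hyH : y ∈ H ∩ R s
      · exact Or.inr hyH
      · left
        rw [hOe, mem_iInter] at hyH
        push Not at hyH
        obtain ⟨m, hm⟩ := hyH
        exact hc' ⟨hyA, mem_iUnion.2 ⟨m, hy, hm⟩⟩
    obtain ⟨D', hD'A, hD', hc'⟩ := K_compl.1 (hcon _ (hsub.trans ker_sub) isClosed_closure hnd)
    refine K_compl.2 ⟨D ∪ D', union_subset hDA hD'A, Pz_union hD hD', ?_⟩
    rintro x ⟨hxA, hxR⟩
    rcases hc ⟨hxA, hxR⟩ with h | h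
    · exact Or.inl h
    · exact Or.inr (hc' ⟨hxA, subset_closure ⟨h, hxR⟩⟩)
  have hall : A ∩ C ⊆ ⋃ s, R s := by
    rintro x ⟨hxA, hxC⟩
    by_contra hxR
    rw [mem_iUnion] at hxR
    push Not at hxR
    have hstep : ∀ s, ∃ n, x ∈ ker k A C (Sp F s) → x ∈ ker k A C (Sp F (s ++ [n])) := by
      intro s
      by_cases hs : x ∈ ker k A C (Sp F s)
      · have := hxR s
        have h2 : x ∉ ⋂ n, us k A C (Sp F (s ++ [n])) := fun h => this ⟨hs, h⟩
        rw [mem_iInter] at h2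
        push Not at h2
        obtain ⟨n, hn⟩ := h2
        exact ⟨n, fun _ => ⟨hxC, hn⟩⟩
      · exact ⟨0, fun h => absurd h hs⟩
    choose c hcs using hstep
    let l : ℕ → List ℕ := fun n => Nat.rec [] (fun _ s => s ++ [c s]) n
    have hl : ∀ n, x ∈ ker k A C (Sp F (l n)) := by
      intro n
      induction n with
      | zero => 
        show x ∈ ker k A C (Sp F [])
        rw [← hAS, NK_ker_eq hNK]; exact hxC
      | succ n ih => exact hcs _ ih
    have : x ∈ Sp F [] := Sp_branch F l rfl (fun n => ⟨c (l n), rfl⟩) fun n =>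
      NK_sub (ker_closed hC) ker_NK (hF _) (Sp_sub F _) (hl n)
    rw [← hAS] at this
    exact this hxA
  obtain ⟨x, hx⟩ := hne
  exact hNK x hx 0 (K_mono (K_compl_iUnion hR) (fun y hy => hall ⟨hy.1, hy.2.1⟩) Subset.rfl)

end HF

end


section
set_option linter.unusedSectionVars false
set_option linter.unusedVariables false

namespace HF
open PiNat
variable {T : Type u} [TopologicalSpace T] [DiscreteTopology T]

/-- nodes of the construction -/
structure Node (k : Cardinal.{u}) (A : Set (ℕ → T)) (F : List ℕ → Set (ℕ → T)) where
  C : Set (ℕ → T)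
  s : List ℕ
  closed : IsClosed C
  ne : C.Nonempty
  nk : NK k A C (Sp F s)

variable {k : Cardinal.{u}} {A : Set (ℕ → T)} {F : List ℕ → Set (ℕ → T)}

theorem node_E (hF : ∀ l, IsClosed (F l)) (hAS : Aᶜ = Sp F []) (p : Node k A F) :
    ∃ E : Set (ℕ → T), E ⊆ p.C ∧ IsClosed E ∧ E.Nonempty ∧ ND E p.C ∧ NK k A E Aᶜ := by
  obtain ⟨E, h1, h2, h3, h4⟩ := key_nd hF hAS p.closed p.ne
    (NK_mono p.nk (by rw [hAS]; exact Sp_sub_nil F _))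
  refine ⟨ker k A E Aᶜ, ker_sub.trans h1, ker_closed h2, ker_nonempty h4, ?_, ker_NK⟩
  intro x hx n
  obtain ⟨y, hy, hyE⟩ := h3 x hx n
  exact ⟨y, hy, fun h => hyE (ker_sub h)⟩

theorem node_child (p : Node k A F) (W : Set (ℕ → T)) :
    ∃ q : Node k A F, (∃ y ∈ p.C, ∃ n, W = cylinder y n) →
      q.C ⊆ p.C ∩ W ∧ ∃ m, q.s = p.s ++ [m] := by
  by_cases h : ∃ y ∈ p.C, ∃ n, W = cylinder y n
  · obtain ⟨y, hy, n, rfl⟩ := h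
    have h1 : ∃ m, ¬ K k A (p.C ∩ cylinder y n) (Sp F (p.s ++ [m])) := by
      by_contra! hc
      exact p.nk y hy n (K_mono (K_iInter hc) (fun _ h => h.2) (Sp_split F _))
    obtain ⟨m, hm⟩ := h1
    exact ⟨⟨ker k A (p.C ∩ cylinder y n) (Sp F (p.s ++ [m])), p.s ++ [m],
      ker_closed (p.closed.inter (cyl_clopen y n)), ker_nonempty hm, ker_NK⟩,
      fun _ => ⟨ker_sub, m, rfl⟩⟩
  · exact ⟨p, fun h' => absurd h' h⟩

theorem main_M (hF : ∀ l, IsClosed (F l)) (hAS : Aᶜ = Sp F []) {C₀ : Set (ℕ → T)}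
    (hC₀ : IsClosed C₀) (hK : ¬ K k A C₀ Aᶜ) :
    ∃ M ⊆ C₀, IsClosed M ∧ M.Nonempty ∧ (∀ x ∈ M, ∀ n, ¬ Pz k (A ∩ (M ∩ cylinder x n))) ∧
      ∃ L : ℕ → Set (ℕ → T), (∀ n, IsClosed (L n)) ∧ A ∩ M ⊆ (⋃ n, L n) ∧
        ∀ n, ∀ x ∈ A ∩ M, ∀ j, ∃ y ∈ A ∩ M, y ∈ cylinder x j ∧ y ∉ L n := by
  choose E hEC hEcl hEne hEnd hENK using node_E (k := k) hF hAS
  choose ch hch using node_child (k := k) (A := A) (F := F)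
  let Q : Node k A F → Set (ℕ → T) → Prop := fun p V => Disjoint V (E p)
  let W : Node k A F → (ℕ → T) → Set (ℕ → T) := fun p y => mc (Q p) y
  have huc : ∀ p y, y ∉ E p → y ∈ uc (Q p) := by
    intro p y hy
    obtain ⟨n, hn⟩ := cyl_sub ((hEcl p).isOpen_compl.mem_nhds hy)
    exact ⟨n, disjoint_left.2 fun z hz => hn hz⟩
  have hWE : ∀ p y, y ∉ E p → ∀ z ∈ W p y, z ∉ E p := fun p y hy z hz =>
    disjoint_left.1 (show Q p (mc (Q p) y) from mc_spec (huc p y hy)) hz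
  have hWW : ∀ p y, y ∉ E p → ∀ z ∈ W p y, W p z = W p y := fun p y hy z hz =>
    mc_eq (huc p y hy) hz
  have hchC : ∀ p, ∀ y ∈ p.C, (ch p (W p y)).C ⊆ p.C ∩ W p y := fun p y hy =>
    (hch p (W p y) ⟨y, hy, _, rfl⟩).1
  have hchs : ∀ p, ∀ y ∈ p.C, ∃ m, (ch p (W p y)).s = p.s ++ [m] := fun p y hy =>
    (hch p (W p y) ⟨y, hy, _, rfl⟩).2
  -- levels
  let DD : ℕ → Node k A F → Set (ℕ → T) := fun n => Nat.rec (fun _ => ∅)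
    (fun _ D p => E p ∪ {x | ∃ y ∈ p.C, y ∉ E p ∧ x ∈ D (ch p (W p y))}) n
  have DD0 : ∀ p, DD 0 p = ∅ := fun p => rfl
  have DDs : ∀ n p, DD (n + 1) p = E p ∪ {x | ∃ y ∈ p.C, y ∉ E p ∧ x ∈ DD n (ch p (W p y))} :=
    fun n p => rfl
  have DDC : ∀ n p, DD n p ⊆ p.C := by
    intro n
    induction n with
    | zero => intro p; rw [DD0]; exact empty_subset _
    | succ n ih =>
      intro p x hx
      rw [DDs] at hx
      rcases hx with hx | ⟨y, hy, hyE, hx⟩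
      · exact hEC p hx
      · exact (hchC p y hy (ih _ hx)).1
  have DDloc : ∀ n p y, y ∈ p.C → y ∉ E p → ∀ z ∈ W p y,
      (z ∈ DD (n + 1) p ↔ z ∈ DD n (ch p (W p y))) := by
    intro n p y hy hyE z hz
    rw [DDs]
    constructor
    · rintro (h | ⟨y', hy', hyE', h⟩)
      · exact absurd h (hWE p y hyE z hz)
      · have h1 := (hchC p y' hy' (DDC _ _ h)).2
        rw [← hWW p y hyE z hz, hWW p y' hyE' z h1]
        exact h
    · intro h
      exact Or.inr ⟨y, hy, hyE, h⟩
  have DDcl : ∀ n p, IsClosed (DD n p) := by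
    intro n
    induction n with
    | zero => intro p; rw [DD0]; exact isClosed_empty
    | succ n ih =>
      intro p
      rw [← isOpen_compl_iff, isOpen_iff_mem_nhds]
      intro x hx
      by_cases hxC : x ∈ p.C
      · have hxE : x ∉ E p := fun h => hx (by rw [DDs]; exact Or.inl h)
        have h1 : x ∉ DD n (ch p (W p x)) := fun h => 
          hx ((DDloc n p x hxC hxE x (mc_self _ x)).2 h)
        filter_upwards [(mc_open (Q p) x).mem_nhds (mc_self _ x),
          (ih (ch p (W p x))).isOpen_compl.mem_nhds h1] with z hz hz2 hz3
        exact hz2 ((DDloc n p x hxC hxE z hz).1 hz3)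
      · filter_upwards [p.closed.isOpen_compl.mem_nhds hxC] with z hz hz2
        exact hz (DDC (n + 1) p hz2)
  let D : Node k A F → Set (ℕ → T) := fun p => ⋃ n, DD n p
  have DC : ∀ p, D p ⊆ p.C := fun p => iUnion_subset fun n => DDC n p
  have ED : ∀ p, E p ⊆ D p := fun p x hx => mem_iUnion.2 ⟨0 + 1, by rw [DDs]; exact Or.inl hx⟩
  have Dloc : ∀ p y, y ∈ p.C → y ∉ E p → ∀ z ∈ W p y, (z ∈ D p ↔ z ∈ D (ch p (W p y))) := by
    intro p y hy hyE z hz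
    constructor
    · intro h
      obtain ⟨n, hn⟩ := mem_iUnion.1 h
      cases n with
      | zero => rw [DD0] at hn; exact hn.elim
      | succ n => exact mem_iUnion.2 ⟨n, (DDloc n p y hy hyE z hz).1 hn⟩
    · intro h
      obtain ⟨n, hn⟩ := mem_iUnion.1 h
      exact mem_iUnion.2 ⟨n + 1, (DDloc n p y hy hyE z hz).2 hn⟩
  -- every point is in some `E q`
  have hq : ∀ n p, ∀ x ∈ DD n p, ∃ q, x ∈ E q ∧ E q ⊆ D p := by
    intro n
    induction n with
    | zero => intro p x hx; rw [DD0] at hx; exact hx.elim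
    | succ n ih =>
      intro p x hx
      rw [DDs] at hx
      rcases hx with hx | ⟨y, hy, hyE, hx⟩
      · exact ⟨p, hx, ED p⟩
      · obtain ⟨q, hq1, hq2⟩ := ih _ x hx
        refine ⟨q, hq1, fun z hz => ?_⟩
        have h1 := hq2 hz
        exact (Dloc p y hy hyE z (hchC p y hy (DC _ h1)).2).2 h1
  -- small cylinders near E
  have hnear : ∀ p, ∀ x ∈ E p, ∀ j, ∃ y ∈ p.C, y ∉ E p ∧ W p y ⊆ cylinder x j := by
    intro p x hx j
    obtain ⟨y, ⟨hyC, hyc⟩, hyE⟩ := hEnd p x (hEC p hx) j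
    refine ⟨y, hyC, hyE, ?_⟩
    have h1 : x ∉ W p y := fun h => hWE p y hyE x h hx
    have h2 : j < sInf {n | Q p (cylinder y n)} := by
      by_contra! hle
      exact h1 (cylinder_anti y hle ((mem_cylinder_comm _ _ _).1 hyc))
    rw [← cyl_eq hyc le_rfl]
    exact cylinder_anti y h2.le
  have hEA : ∀ p, (A ∩ E p).Nonempty := by
    intro p
    obtain ⟨x, hx⟩ := hEne p
    obtain ⟨z, hz⟩ := NK_dense (hENK p) hx 0
    exact ⟨z, hz.1, hz.2.1⟩
  have hnd : ∀ n p, ∀ x ∈ A ∩ D p, ∀ j, ∃ y ∈ A ∩ D p, y ∈ cylinder x j ∧ y ∉ DD n p := by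
    intro n
    induction n with
    | zero => intro p x hx j; exact ⟨x, hx, self_mem_cylinder x j, by rw [DD0]; exact id⟩
    | succ n ih =>
      intro p x hx j
      by_cases hxE : x ∈ E p
      · obtain ⟨y, hy, hyE, hyW⟩ := hnear p x hxE j
        obtain ⟨z, hzA, hzE⟩ := hEA (ch p (W p y))
        obtain ⟨w, hw, -, hw3⟩ := ih (ch p (W p y)) z ⟨hzA, ED _ hzE⟩ 0
        have hwW : w ∈ W p y := (hchC p y hy (DC _ hw.2)).2
        exact ⟨w, ⟨hw.1, (Dloc p y hy hyE w hwW).2 hw.2⟩, hyW hwW,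
          fun h => hw3 ((DDloc n p y hy hyE w hwW).1 h)⟩
      · have hxC := DC p hx.2
        have h1 := (Dloc p x hxC hxE x (mc_self _ x)).1 hx.2
        obtain ⟨w, hw, hw2, hw3⟩ := ih (ch p (W p x)) x ⟨hx.1, h1⟩ j
        have hwW : w ∈ W p x := (hchC p x hxC (DC _ hw.2)).2
        exact ⟨w, ⟨hw.1, (Dloc p x hxC hxE w hwW).2 hw.2⟩, hw2,
          fun h => hw3 ((DDloc n p x hxC hxE w hwW).1 h)⟩
  -- limits of branches are outside `A`
  have hlim : ∀ p, p.s = [] → A ∩ closure (D p) ⊆ D p := by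
    rintro p hps x ⟨hxA, hx⟩
    by_contra hxD
    have hclC : ∀ q, closure (D q) ⊆ q.C := fun q => closure_minimal (DC q) q.closed
    have hstep : ∀ q, x ∈ closure (D q) ∧ x ∉ D q → 
        x ∈ closure (D (ch q (W q x))) ∧ x ∉ D (ch q (W q x)) := by
      rintro q ⟨h1, h2⟩
      have hxE : x ∉ E q := fun h => h2 (ED q h)
      have hxC := hclC q h1
      refine ⟨?_, fun h => h2 ((Dloc q x hxC hxE x (mc_self _ x)).2 h)⟩
      rw [mem_closure_iff_nhds] at h1 ⊢
      intro N hN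
      obtain ⟨z, ⟨hz1, hz2⟩, hz3⟩ := h1 (N ∩ W q x) 
        (inter_mem hN ((mc_open (Q q) x).mem_nhds (mc_self _ x)))
      exact ⟨z, hz1, (Dloc q x hxC hxE z hz2).1 hz3⟩
    let ps : ℕ → Node k A F := fun n => Nat.rec p (fun _ q => ch q (W q x)) n
    have hpss : ∀ n, ps (n + 1) = ch (ps n) (W (ps n) x) := fun n => rfl
    have hps' : ∀ n, x ∈ closure (D (ps n)) ∧ x ∉ D (ps n) := by
      intro n
      induction n with
      | zero => exact ⟨hx, hxD⟩
      | succ n ih => rw [hpss]; exact hstep _ ih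
    have : x ∈ Sp F [] := by
      refine Sp_branch F (fun n => (ps n).s) hps (fun n => ?_) (fun n => ?_)
      · show ∃ m, (ps (n + 1)).s = (ps n).s ++ [m]
        rw [hpss]
        exact hchs _ _ (hclC _ (hps' n).1)
      · exact NK_sub (ps n).closed (ps n).nk (hF _) (Sp_sub F _) (hclC _ (hps' n).1)
    rw [← hAS] at this
    exact this hxA
  -- the root
  let p : Node k A F := ⟨ker k A C₀ Aᶜ, [], ker_closed hC₀, ker_nonempty hK, by
    rw [← hAS]; exact ker_NK⟩
  have hAM : A ∩ closure (D p) = A ∩ D p := Subset.antisymm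
    (fun x hx => ⟨hx.1, hlim p rfl hx⟩) (inter_subset_inter_right _ subset_closure)
  refine ⟨closure (D p), ?_, isClosed_closure, ?_, ?_, fun n => DD n p, fun n => DDcl n p, ?_, ?_⟩
  · exact (closure_minimal (DC p) p.closed).trans ker_sub
  · obtain ⟨x, hx⟩ := hEne p
    exact ⟨x, subset_closure (ED p hx)⟩
  · intro x hx n hP
    rw [mem_closure_iff] at hx
    obtain ⟨z, hz, hzD⟩ := hx _ (isOpen_cylinder _ x n) (self_mem_cylinder x n)
    obtain ⟨m, hm⟩ := mem_iUnion.1 hzD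
    obtain ⟨q, hq1, hq2⟩ := hq m p z hm
    refine hENK q z hq1 n ((K_compl_iff (closed_Gδ ((hEcl q).inter (cyl_clopen z n)))).2 ?_)
    have := Pz_inter hP (closed_Gδ ((hEcl q).inter (cyl_clopen z n)))
    convert this using 1
    ext y
    constructor
    · rintro ⟨h1, h2, h3⟩
      exact ⟨⟨h1, subset_closure (hq2 h2), by rw [← cyl_eq hz le_rfl]; exact h3⟩, h2, h3⟩
    · rintro ⟨⟨h1, -⟩, h2⟩
      exact ⟨h1, h2⟩
  · rw [hAM]; exact inter_subset_right
  · rw [hAM]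
    exact fun n => hnd n p

end HF

end


section
set_option linter.unusedSectionVars false
set_option linter.unusedVariables false
namespace HF
open PiNat
variable {T : Type u} [TopologicalSpace T] [DiscreteTopology T]

theorem metr_pi : TopologicalSpace.MetrizableSpace (ℕ → T) := inferInstance

/-- Lavrentiev type lemma -/
theorem lav {B Y : Type u} [TopologicalSpace B] [TopologicalSpace Y]
    [TopologicalSpace.MetrizableSpace Y] {j : B → ℕ → T} {f : B → Y} (hj : IsEmbedding j)
    (hf : IsEmbedding f) {G : Set (ℕ → T)} (hG : IsGδ G) (hGr : G ⊆ range j) :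
    IsGδ (f '' (j ⁻¹' G)) := by
  obtain ⟨O, hO, rfl⟩ := isGδ_iff_eq_iInter_nat.1 hG
  set G := ⋂ n, O n with hGdef
  let Z := f '' (j ⁻¹' G)
  let R : ℕ → Set (Set Y) := fun n => {U | IsOpen U ∧ ∃ x, ∃ m, n ≤ m ∧ cylinder x m ⊆ O n ∧
    j '' (f ⁻¹' U) ⊆ cylinder x m}
  have key : Z = closure Z ∩ ⋂ n, ⋃₀ (R n) := by
    apply Subset.antisymm
    · rintro _ ⟨b, hb, rfl⟩
      refine ⟨subset_closure ⟨b, hb, rfl⟩, mem_iInter.2 fun n => ?_⟩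
      have hbO : j b ∈ O n := mem_iInter.1 hb n
      obtain ⟨m, hm⟩ := cyl_sub ((hO n).mem_nhds hbO)
      have h1 : j ⁻¹' (cylinder (j b) (max n m)) ∈ 𝓝 b :=
        hj.continuous.continuousAt (cyl_nhds _ _)
      rw [hf.nhds_eq_comap] at h1
      obtain ⟨V, hV, hVs⟩ := h1
      obtain ⟨U, hUV, hU, hbU⟩ := mem_nhds_iff.1 hV
      refine ⟨U, ⟨hU, j b, max n m, le_max_left _ _, 
        (cylinder_anti _ (le_max_right _ _)).trans hm, ?_⟩, hbU⟩
      rintro _ ⟨c, hc, rfl⟩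
      exact hVs (hUV hc)
    · rintro y ⟨hy, hyR⟩
      have h1 : ∀ n, ∃ U, (IsOpen U ∧ ∃ x, ∃ m, n ≤ m ∧ cylinder x m ⊆ O n ∧
          j '' (f ⁻¹' U) ⊆ cylinder x m) ∧ y ∈ U := fun n => mem_iInter.1 hyR n
      choose U hU hyU using h1
      choose hUo x m hnm hxO hjU using hU
      let z : ℕ → T := fun i => x (i + 1) i
      -- approximating points
      have happ : ∀ N ∈ 𝓝 y, ∃ b, j b ∈ G ∧ f b ∈ N := by
        intro N hN
        obtain ⟨_, h2, b, hb, rfl⟩ := mem_closure_iff_nhds.1 hy N hN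
        exact ⟨b, hb, h2⟩
      have hb : ∀ b n, f b ∈ U n → j b ∈ cylinder (x n) (m n) := fun b n h =>
        hjU n ⟨b, h, rfl⟩
      have hz : ∀ n, z ∈ cylinder (x n) (m n) := by
        intro n i hi
        obtain ⟨b, -, hb2⟩ := happ (U n ∩ U (i + 1)) 
          (inter_mem ((hUo n).mem_nhds (hyU n)) ((hUo _).mem_nhds (hyU _)))
        have e1 := hb b n hb2.1 i hi
        have e2 := hb b (i + 1) hb2.2 i (lt_of_lt_of_le (Nat.lt_succ_self i) (hnm _))
        exact e2.symm.trans e1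
      have hzG : z ∈ G := mem_iInter.2 fun n => hxO n (hz n)
      obtain ⟨b, hbz⟩ := hGr hzG
      refine ⟨b, by rw [mem_preimage, hbz]; exact hzG, ?_⟩
      by_contra hne
      obtain ⟨V, V', hV, hV', hbV, hyV, hd⟩ := t2_separation hne
      have h2 : f ⁻¹' V ∈ 𝓝 b := hf.continuous.continuousAt (hV.mem_nhds hbV)
      rw [hj.nhds_eq_comap] at h2
      obtain ⟨S, hS, hSV⟩ := h2
      rw [hbz] at hS
      obtain ⟨n, hn⟩ := cyl_sub hS
      obtain ⟨c, -, hc⟩ := happ (U n ∩ V') 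
          (inter_mem ((hUo n).mem_nhds (hyU n)) (hV'.mem_nhds hyV))
      have h3 : j c ∈ cylinder z n := by
        have := hb c n hc.1
        rw [← cyl_eq (hz n) le_rfl] at this
        exact cylinder_anti _ (hnm n) this
      exact disjoint_left.1 hd (hSV (hn h3)) hc.2
  letI := TopologicalSpace.metrizableSpaceMetric Y
  change IsGδ Z
  rw [key]
  exact isClosed_closure.isGδ.inter (IsGδ.iInter_of_isOpen fun n => isOpen_sUnion fun U hU => hU.1)

theorem SLW_of_Pz {k : Cardinal.{u}} {Z : Set (ℕ → T)} (h : Pz k Z) : SLWplusGDS ↥Z k := by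
  obtain ⟨G, S, hG, hGZ, hS, hc⟩ := h
  refine ⟨Subtype.val ⁻¹' (⋃ n, S n), Subtype.val ⁻¹' (⋃ n, G n), ?_, ?_, ?_, ?_⟩
  · rw [eq_univ_iff_forall]
    rintro ⟨x, hx⟩
    exact (hc hx).symm
  · refine ⟨fun n => {x | x.1.1 ∈ S n}, ?_, fun n => ?_⟩
    · rw [eq_univ_iff_forall]
      rintro ⟨⟨x, hx⟩, hx2⟩
      obtain ⟨n, hn⟩ := mem_iUnion.1 hx2
      exact mem_iUnion.2 ⟨n, hn⟩
    · refine LW_of_LWs (i := fun x => x.1.1.1) (IsEmbedding.subtypeVal.comp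
        (IsEmbedding.subtypeVal.comp IsEmbedding.subtypeVal)) (LWs_mono ?_ (hS n))
      rintro _ ⟨x, rfl⟩
      exact x.2
  · infer_instance
  · intro Y _ _ f hf
    have hj : IsEmbedding (fun x : ↥(Subtype.val ⁻¹' (⋃ n, G n) : Set ↥Z) => x.1.1) :=
      IsEmbedding.subtypeVal.comp IsEmbedding.subtypeVal
    refine ⟨fun n => f '' ((fun x => x.1.1) ⁻¹' (G n)), fun n => lav hj hf (hG n) ?_, ?_⟩
    · intro x hx
      exact ⟨⟨⟨x, hGZ n hx⟩, mem_iUnion.2 ⟨n, hx⟩⟩, rfl⟩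
    · apply Subset.antisymm
      · rintro _ ⟨x, rfl⟩
        obtain ⟨n, hn⟩ := mem_iUnion.1 x.2
        exact mem_iUnion.2 ⟨n, x, hn, rfl⟩
      · exact iUnion_subset fun n => image_subset_range _ _

theorem Pz_of_SLW {k : Cardinal.{u}} {U : Type u} [TopologicalSpace U] {j : U → ℕ → T}
    (hj : IsEmbedding j) (h : SLWplusGDS U k) : Pz k (range j) := by
  obtain ⟨A, B, hAB, ⟨S, hSu, hS⟩, -, hB⟩ := h
  obtain ⟨G, hG, hGe⟩ := hB (ℕ → T) (fun x => j x.1) (hj.comp IsEmbedding.subtypeVal)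
  refine ⟨G, fun n => range fun x : ↥(S n) => j x.1.1, hG, fun n => ?_, fun n => ?_, ?_⟩
  · intro x hx
    have : x ∈ range (fun x : ↥B => j x.1) := by rw [hGe]; exact mem_iUnion.2 ⟨n, hx⟩
    obtain ⟨y, rfl⟩ := this
    exact mem_range_self _
  · exact LWs_of_emb (hj.comp (IsEmbedding.subtypeVal.comp IsEmbedding.subtypeVal)) (hS n)
  · rintro _ ⟨u, rfl⟩
    rcases (hAB ▸ mem_univ u : u ∈ A ∪ B) with hu | hu
    · right
      obtain ⟨n, hn⟩ := mem_iUnion.1 (hSu ▸ mem_univ (⟨u, hu⟩ : ↥A) : (⟨u, hu⟩ : ↥A) ∈ ⋃ n, S n)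
      exact mem_iUnion.2 ⟨n, ⟨⟨u, hu⟩, hn⟩, rfl⟩
    · left
      rw [← hGe]
      exact ⟨⟨u, hu⟩, rfl⟩

end HF

end


section
set_option linter.unusedSectionVars false
set_option linter.unusedVariables false
namespace HF
open PiNat
variable {T : Type u} [TopologicalSpace T] [DiscreteTopology T]

/-- a partition of a cylinder trace into smaller ones, indexed by `T` -/
def Part (M : Set (ℕ → T)) (x : ℕ → T) (n : ℕ) (c : T → (ℕ → T) × ℕ) : Prop :=
  (∀ a, (c a).1 ∈ M ∩ cylinder x n) ∧ (∀ a, n < (c a).2) ∧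
  (∀ a b z, z ∈ cylinder (c a).1 (c a).2 → z ∈ cylinder (c b).1 (c b).2 → a = b) ∧
  ∀ z ∈ M ∩ cylinder x n, ∃ a, z ∈ cylinder (c a).1 (c a).2

theorem homeo_of_part {M : Set (ℕ → T)} (hM : IsClosed M) (hne : M.Nonempty)
    (hP : ∀ x ∈ M, ∀ n, ∃ c, Part M x n c) : Nonempty (↥M ≃ₜ (ℕ → T)) := by
  obtain ⟨x0, hx0⟩ := hne
  choose c hc using hP
  let ch : ↥M × ℕ → T → ↥M × ℕ := fun p a =>
    (⟨(c p.1.1 p.1.2 p.2 a).1, ((hc p.1.1 p.1.2 p.2).1 a).1⟩, (c p.1.1 p.1.2 p.2 a).2)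
  let cy : ↥M × ℕ → Set (ℕ → T) := fun p => cylinder p.1.1 p.2
  have ch1 : ∀ p a, (ch p a).1.1 ∈ cy p := fun p a => ((hc p.1.1 p.1.2 p.2).1 a).2
  have ch2 : ∀ p a, p.2 < (ch p a).2 := fun p a => (hc p.1.1 p.1.2 p.2).2.1 a
  have ch3 : ∀ p a b z, z ∈ cy (ch p a) → z ∈ cy (ch p b) → a = b := fun p =>
    (hc p.1.1 p.1.2 p.2).2.2.1
  have ch4 : ∀ p, ∀ z : ℕ → T, ∃ a, z ∈ M ∩ cy p → z ∈ cy (ch p a) := by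
    intro p z
    by_cases h : z ∈ M ∩ cy p
    · obtain ⟨a, ha⟩ := (hc p.1.1 p.1.2 p.2).2.2.2 z h
      exact ⟨a, fun _ => ha⟩
    · exact ⟨x0 0, fun h' => (h h').elim⟩
  have chsub : ∀ p a, cy (ch p a) ⊆ cy p := by
    intro p a
    have : cylinder (ch p a).1.1 p.2 = cy p := cyl_eq (ch1 p a) le_rfl
    rw [← this]
    exact cylinder_anti _ (ch2 p a).le
  choose dg hdg using ch4
  let st : (ℕ → T) → ℕ → ↥M × ℕ := fun y n => Nat.rec (⟨x0, hx0⟩, 0) (fun i p => ch p (y i)) n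
  have st0 : ∀ y, st y 0 = (⟨x0, hx0⟩, 0) := fun y => rfl
  have sts : ∀ y n, st y (n + 1) = ch (st y n) (y n) := fun y n => rfl
  have stl : ∀ y n, n ≤ (st y n).2 := by
    intro y n
    induction n with
    | zero => exact Nat.zero_le _
    | succ n ih => rw [sts]; exact lt_of_le_of_lt ih (ch2 _ _)
  have stanti : ∀ y n m, n ≤ m → cy (st y m) ⊆ cy (st y n) := by
    intro y n m h
    induction m, h using Nat.le_induction with
    | base => exact Subset.rfl
    | succ m h ih => rw [sts]; exact (chsub _ _).trans ih
  have stself : ∀ y n, (st y n).1.1 ∈ cy (st y n) := fun y n => self_mem_cylinder _ _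
  let φ : (ℕ → T) → ℕ → T := fun y i => (st y (i + 1)).1.1 i
  have hφ : ∀ y n, φ y ∈ cy (st y n) := by
    intro y n i hi
    rcases le_total n (i + 1) with h | h
    · exact stanti y n (i + 1) h (stself y (i + 1)) i hi
    · exact (stanti y (i + 1) n h (stself y n) i (stl y (i + 1))).symm
  have huniq : ∀ y z, (∀ n, z ∈ cy (st y n)) → z = φ y := by
    intro y z h
    funext i
    exact h (i + 1) i (stl y (i + 1))
  have hφM : ∀ y, φ y ∈ M := by
    intro y
    rw [← hM.closure_eq, mem_closure_iff_nhds]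
    intro N hN
    obtain ⟨n, hn⟩ := cyl_sub hN
    refine ⟨(st y n).1.1, hn ?_, (st y n).1.2⟩
    have := hφ y n
    exact (mem_cylinder_comm _ _ _).1 (cylinder_anti _ (stl y n) this)
  have hst : ∀ n y y', y' ∈ cylinder y n → st y' n = st y n := by
    intro n
    induction n with
    | zero => intro y y' _; rw [st0, st0]
    | succ n ih =>
      intro y y' h
      rw [sts, sts, ih y y' (cylinder_anti _ (Nat.le_succ n) h), h n (Nat.lt_succ_self n)]
  have hback : ∀ n y y', φ y' ∈ cy (st y n) → y' ∈ cylinder y n := by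
    intro n
    induction n with
    | zero => intro y y' _ i hi; exact (Nat.not_lt_zero _ hi).elim
    | succ n ih =>
      intro y y' h
      have h1 := ih y y' (stanti y n (n + 1) (Nat.le_succ n) h)
      have h2 := hφ y' (n + 1)
      rw [sts] at h2 h
      rw [hst n y y' h1] at h2
      have h3 := ch3 _ _ _ _ h2 h
      intro i hi
      rcases Nat.lt_succ_iff_lt_or_eq.1 hi with h4 | rfl
      · exact h1 i h4
      · exact h3
  have hinj : ∀ y y', φ y = φ y' → y = y' := by
    intro y y' h
    funext i
    exact hback (i + 1) y' y (by rw [h]; exact hφ y' (i + 1)) i (Nat.lt_succ_self i)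
  have hsurj : ∀ z ∈ M, ∃ y, φ y = z := by
    intro z hz
    let sz : ℕ → ↥M × ℕ := fun n => Nat.rec (⟨x0, hx0⟩, 0) (fun i p => ch p (dg p z)) n
    let y : ℕ → T := fun n => dg (sz n) z
    have e : ∀ n, st y n = sz n := by
      intro n
      induction n with
      | zero => rfl
      | succ n ih => 
        rw [sts, ih]
    refine ⟨y, (huniq y z fun n => ?_).symm⟩
    induction n with
    | zero => intro i hi; exact (Nat.not_lt_zero _ hi).elim
    | succ n ih =>
      rw [sts]
      have := hdg (st y n) z ⟨hz, ih⟩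
      rw [show y n = dg (st y n) z by rw [e]]
      exact this
  let e : (ℕ → T) ≃ ↥M := Equiv.ofBijective (fun y => ⟨φ y, hφM y⟩)
    ⟨fun y y' h => hinj y y' (congrArg Subtype.val h), fun z => by
      obtain ⟨y, hy⟩ := hsurj z.1 z.2
      exact ⟨y, Subtype.ext hy⟩⟩
  have he : ∀ y, (e y).1 = φ y := fun y => rfl
  refine ⟨(Homeomorph.mk e ?_ ?_).symm⟩
  · refine Continuous.subtype_mk (f := φ) ?_ hφM
    rw [continuous_iff_continuousAt]
    intro y N hN
    obtain ⟨n, hn⟩ := cyl_sub hN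
    rw [mem_map]
    filter_upwards [cyl_nhds y n] with y' hy'
    apply hn
    have h1 := hφ y' n
    rw [hst n y y' hy'] at h1
    have h2 := hφ y n
    have h3 : cylinder (φ y) n = cylinder (st y n).1.1 n := cyl_eq h2 (stl y n)
    rw [h3]
    exact cylinder_anti _ (stl y n) h1
  · rw [continuous_iff_continuousAt]
    intro z
    obtain ⟨y, rfl⟩ := e.surjective z
    intro N hN
    rw [Equiv.invFun_as_coe, Equiv.symm_apply_apply] at hN
    obtain ⟨n, hn⟩ := cyl_sub hN
    have h1 : Subtype.val ⁻¹' (cy (st y n)) ∈ 𝓝 (e y) := by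
      refine continuous_subtype_val.continuousAt ((isOpen_cylinder _ _ _).mem_nhds ?_)
      rw [he]; exact hφ y n
    rw [mem_map]
    filter_upwards [h1] with w hw
    obtain ⟨y', rfl⟩ := e.surjective w
    show e.symm (e y') ∈ N
    rw [Equiv.symm_apply_apply]
    exact hn (hback n y y' hw)

end HF

end


section
set_option linter.unusedSectionVars false
set_option linter.unusedVariables false
namespace HF
open PiNat
variable {T : Type u} [TopologicalSpace T] [DiscreteTopology T]

theorem wlt_subsingleton {Y : Set (ℕ → T)} (h : Y.Subsingleton) : WeightLT ↥Y Cardinal.aleph0 := by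
  haveI : Subsingleton ↥Y := h.coe_sort
  haveI : Finite ↥Y := Finite.of_subsingleton
  exact ⟨{U | IsOpen U}, TopologicalSpace.isTopologicalBasis_opens, Cardinal.lt_aleph0_of_finite _⟩

theorem part_two (hT : ∀ p q t : T, p ≠ q → t = p ∨ t = q) {M : Set (ℕ → T)} {x : ℕ → T} {n : ℕ}
    (hw : ¬ WeightLT ↥(M ∩ cylinder x n) Cardinal.aleph0) : ∃ c, Part M x n c := by
  classical
  have h1 : ∃ j, ∃ a ∈ M ∩ cylinder x n, ∃ b ∈ M ∩ cylinder x n, a j ≠ b j := by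
    by_contra! hcon
    exact hw (wlt_subsingleton fun a ha b hb => funext fun j => hcon j a ha b hb)
  let j := Nat.find h1
  obtain ⟨a, ha, b, hb, hab⟩ : ∃ a ∈ M ∩ cylinder x n, ∃ b ∈ M ∩ cylinder x n, a j ≠ b j :=
    Nat.find_spec h1
  have hmin : ∀ i < j, ∀ a ∈ M ∩ cylinder x n, ∀ b ∈ M ∩ cylinder x n, a i = b i := by
    intro i hi a ha b hb
    by_contra hne
    exact Nat.find_min h1 hi ⟨a, ha, b, hb, hne⟩
  have hj : n ≤ j := by
    by_contra! hlt
    exact hab ((ha.2 j hlt).trans (hb.2 j hlt).symm)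
  have h2 : ∀ t : T, ∃ y ∈ M ∩ cylinder x n, y j = t := by
    intro t
    rcases hT _ _ t hab with rfl | rfl
    · exact ⟨a, ha, rfl⟩
    · exact ⟨b, hb, rfl⟩
  choose y hy hyj using h2
  refine ⟨fun t => (y t, j + 1), hy, fun t => Nat.lt_succ_of_le hj, ?_, ?_⟩
  · intro s t z hs ht
    have e1 := hs j (Nat.lt_succ_self j)
    have e2 := ht j (Nat.lt_succ_self j)
    simp only [hyj] at e1 e2
    exact e1.symm.trans e2
  · intro z hz
    refine ⟨z j, fun i hi => ?_⟩
    rcases Nat.lt_succ_iff_lt_or_eq.1 hi with h4 | rfl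
    · exact hmin i h4 z hz _ (hy _)
    · exact (hyj _).symm

/-- cylinders of level m meeting Y -/
def cs (Y : Set (ℕ → T)) (m : ℕ) : Set (Set (ℕ → T)) := (fun y => cylinder y m) '' Y

theorem wlt_of_cs {Y : Set (ℕ → T)} {k lam : Cardinal.{u}} (hl : Cardinal.aleph0 ≤ lam) 
    (hlk : lam < k) (m0 : ℕ) (h : ∀ m ≥ m0, Cardinal.mk ↥(cs Y m) ≤ lam) : WeightLT ↥Y k := by
  let B : ULift.{u} ℕ → Set (Set ↥Y) := fun m => (fun V => Subtype.val ⁻¹' V) '' cs Y (m0 + m.down)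
  refine ⟨⋃ m, B m, ?_, ?_⟩
  · refine TopologicalSpace.isTopologicalBasis_of_isOpen_of_nhds ?_ ?_
    · intro U hU
      obtain ⟨m, _, ⟨y, hy, rfl⟩, rfl⟩ := mem_iUnion.1 hU
      exact (isOpen_cylinder _ _ _).preimage continuous_subtype_val
    · intro y U hyU hU
      obtain ⟨V, hV, rfl⟩ := isOpen_induced_iff.1 hU
      obtain ⟨n, hn⟩ := cyl_sub (hV.mem_nhds hyU)
      refine ⟨Subtype.val ⁻¹' cylinder y.1 (m0 + n), mem_iUnion.2 ⟨⟨n⟩, _, ⟨y.1, y.2, rfl⟩, rfl⟩,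
        self_mem_cylinder _ _, ?_⟩
      exact preimage_mono ((cylinder_anti _ (Nat.le_add_left _ _)).trans hn)
  · refine lt_of_le_of_lt ?_ hlk
    refine (Cardinal.mk_iUnion_le B).trans ?_
    have h1 : (⨆ m, Cardinal.mk ↥(B m)) ≤ lam :=
      ciSup_le' fun m => Cardinal.mk_image_le.trans (h _ (Nat.le_add_right _ _))
    calc _ ≤ lam * lam := mul_le_mul' (by simpa using hl) h1
      _ = lam := Cardinal.mul_eq_self hl

/-- pieces given by a stopping time -/
def pcs (Y : Set (ℕ → T)) (l : (ℕ → T) → ℕ) : Set (Set (ℕ → T)) := (fun y => cylinder y (l y)) '' Y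

theorem pcs_card [Infinite T] (Y : Set (ℕ → T)) (l : (ℕ → T) → ℕ) :
    Cardinal.mk ↥(pcs Y l) ≤ Cardinal.mk T := by
  rw [← Cardinal.mk_list_eq_mk T]
  let g : List T → Set (ℕ → T) := fun l => {z | res z l.length = l}
  refine (Cardinal.mk_le_mk_of_subset (t := range g) ?_).trans Cardinal.mk_range_le
  rintro _ ⟨y, -, rfl⟩
  refine ⟨res y (l y), ?_⟩
  simp only [g, cylinder_eq_res, res_length]

theorem part_of_time {M : Set (ℕ → T)} {x : ℕ → T} {n : ℕ} {l : (ℕ → T) → ℕ}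
    (hn : ∀ y, n < l y) (hl : ∀ y, ∀ z ∈ cylinder y (l y), l z = l y)
    (hc : Cardinal.mk T = Cardinal.mk ↥(pcs (M ∩ cylinder x n) l)) : ∃ c, Part M x n c := by
  obtain ⟨e⟩ := Cardinal.eq.1 hc
  have h1 : ∀ t, ∃ y ∈ M ∩ cylinder x n, cylinder y (l y) = (e t).1 := fun t => (e t).2
  choose y hy hye using h1
  refine ⟨fun t => (y t, l (y t)), hy, fun t => hn _, ?_, ?_⟩
  · intro a b z ha hb
    apply e.injective
    apply Subtype.ext
    rw [← hye a, ← hye b]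
    have e1 := hl _ z ha
    have e2 := hl _ z hb
    dsimp only at ha hb
    rw [← cyl_eq ha le_rfl, ← cyl_eq hb le_rfl, ← e1, ← e2]
  · intro z hz
    refine ⟨e.symm ⟨cylinder z (l z), z, hz, rfl⟩, ?_⟩
    show z ∈ cylinder (y _) (l (y _))
    rw [hye, Equiv.apply_symm_apply]
    exact self_mem_cylinder _ _

theorem part_big {k : Cardinal.{u}} (hk : Cardinal.aleph0 < k) (hT : Cardinal.mk T = k)
    {M : Set (ℕ → T)} {x : ℕ → T} {n : ℕ} (hx : x ∈ M)
    (hw : ∀ y ∈ M, ∀ m, ¬ WeightLT ↥(M ∩ cylinder y m) k) : ∃ c, Part M x n c := by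
  classical
  haveI : Infinite T := Cardinal.infinite_iff.2 (hT ▸ hk.le)
  set Y := M ∩ cylinder x n with hY
  by_contra hcon
  have hsmall : ∀ l : (ℕ → T) → ℕ, (∀ y, n < l y) → (∀ y, ∀ z ∈ cylinder y (l y), l z = l y) →
      Cardinal.mk ↥(pcs Y l) < k := by
    intro l h1 h2
    rw [← hT]
    exact lt_of_le_of_ne (pcs_card Y l) fun h => hcon (part_of_time h1 h2 h.symm)
  have hN : ∀ m, n < m → Cardinal.mk ↥(cs Y m) < k := fun m hm =>
    hsmall (fun _ => m) (fun _ => hm) (fun _ _ _ => rfl)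
  -- an infinite level
  obtain ⟨m1, hm1, hm1'⟩ : ∃ m1, n + 1 ≤ m1 ∧ Cardinal.aleph0 < Cardinal.mk ↥(cs Y m1) := by
    by_contra! h
    exact hw x hx n (wlt_of_cs le_rfl hk (n + 1) h)
  haveI : Infinite ↥(cs Y m1) := Cardinal.infinite_iff.2 hm1'.le
  let u := Infinite.natEmbedding ↥(cs Y m1)
  have h1 : ∀ i, ∃ y ∈ Y, cylinder y m1 = (u i).1 := fun i => (u i).2
  choose y hy hyu using h1
  have hinj : ∀ i j, cylinder (y i) m1 = cylinder (y j) m1 → i = j := by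
    intro i j h
    rw [hyu, hyu] at h
    exact u.injective (Subtype.ext h)
  have h2 : ∀ i, ∃ m, m1 ≤ m ∧ 
      max Cardinal.aleph0 (Cardinal.mk ↥(cs Y (n + 1 + i))) < 
        Cardinal.mk ↥(cs (M ∩ cylinder (y i) m1) m) := by
    intro i
    by_contra! h
    exact hw (y i) (hy i).1 m1 (wlt_of_cs (le_max_left _ _) 
      (max_lt hk (hN (n + 1 + i) (by omega))) m1 h)
  choose m hm hmc using h2
  let l : (ℕ → T) → ℕ := fun z =>
    if h : ∃ i, cylinder z m1 = cylinder (y i) m1 then m h.choose else m1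
  have hl1 : ∀ z i, cylinder z m1 = cylinder (y i) m1 → l z = m i := by
    intro z i h
    have hex : ∃ i, cylinder z m1 = cylinder (y i) m1 := ⟨i, h⟩
    have : l z = m hex.choose := dif_pos hex
    rw [this, hinj _ _ (hex.choose_spec.symm.trans h)]
  have hl2 : ∀ z, m1 ≤ l z := by
    intro z
    by_cases h : ∃ i, cylinder z m1 = cylinder (y i) m1
    · obtain ⟨i, hi⟩ := h
      rw [hl1 z i hi]; exact hm i
    · exact (dif_neg h : l z = m1).ge
  have hl3 : ∀ z w, cylinder z m1 = cylinder w m1 → l z = l w := by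
    intro z w h
    simp only [l, h]
  have hP := hsmall l (fun z => lt_of_lt_of_le hm1 (hl2 z)) 
    (fun z w hw => hl3 w z (cyl_eq hw (hl2 z)))
  have hbig : ∀ i, max Cardinal.aleph0 (Cardinal.mk ↥(cs Y (n + 1 + i))) < 
      Cardinal.mk ↥(pcs Y l) := by
    intro i
    refine lt_of_lt_of_le (hmc i) (Cardinal.mk_le_mk_of_subset ?_)
    rintro _ ⟨w, ⟨hwM, hwc⟩, rfl⟩
    have e1 := cyl_eq hwc le_rfl
    have e2 : cylinder (y i) n = cylinder x n := cyl_eq (hy i).2 le_rfl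
    refine ⟨w, ⟨hwM, ?_⟩, ?_⟩
    · rw [← e2]
      exact cylinder_anti _ (by omega) hwc
    · simp only [hl1 w i e1]
  refine hw x hx n (wlt_of_cs ((le_max_left _ _).trans (hbig 0).le) hP (n + 1) fun j hj => ?_)
  obtain ⟨i, rfl⟩ := Nat.exists_eq_add_of_le hj
  exact (le_max_right _ _).trans (hbig i).le

theorem homeo_star {k : Cardinal.{u}} (hk : Cardinal.aleph0 ≤ k) {M : Set (ℕ → StarT k)}
    (hM : IsClosed M) (hne : M.Nonempty)
    (hw : ∀ y ∈ M, ∀ m, ¬ WeightLT ↥(M ∩ cylinder y m) k) : Nonempty (↥M ≃ₜ (ℕ → StarT k)) := by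
  refine homeo_of_part hM hne fun x hx n => ?_
  rcases hk.eq_or_lt with h | h
  · refine part_two ?_ (h ▸ hw x hx n)
    have e : StarT k = ULift.{u} Bool := if_pos h.symm
    rw [e]
    rintro ⟨p⟩ ⟨q⟩ ⟨t⟩ hpq
    revert hpq
    cases p <;> cases q <;> cases t <;> simp
  · refine part_big h ?_ hx hw
    have e : StarT k = DiscT k := if_neg h.ne'
    rw [e]
    exact Cardinal.mk_out k

end HF

end


section
set_option linter.unusedSectionVars false
set_option linter.unusedVariables false
namespace HF
open PiNat

theorem final (k : Cardinal.{u}) (hk : Cardinal.aleph0 ≤ k)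
    (F A : Set (ℕ → StarT k)) (hF : IsFsigmaSet F) (hAF : A ⊆ F)
    (hco : IsSuslinIn Aᶜ) (hA : ¬ SLWplusGDS ↥A k) :
    ∃ M : Set (ℕ → StarT k), IsClosed M ∧
      IsClosed (Subtype.val ⁻¹' M : Set ↥A) ∧
      IsNowhereDense (Subtype.val ⁻¹' M : Set ↥A) ∧
      NowhereSLWplusGDS ↥(A ∩ M) k ∧ FirstCategory ↥(A ∩ M) ∧
      M ⊆ F ∧ Nonempty (↥M ≃ₜ (ℕ → StarT k)) := by
  obtain ⟨Fn, hFn, rfl⟩ := hF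
  obtain ⟨Fs, hFs, hAS⟩ := hco
  have hAS' : Aᶜ = Sp Fs [] := by
    rw [hAS]
    ext x
    simp only [mem_iUnion, mem_iInter]
    exact ⟨fun ⟨t, ht⟩ => ⟨t, rfl, ht⟩, fun ⟨t, _, ht⟩ => ⟨t, ht⟩⟩
  have hPz : ¬ Pz k A := fun h => hA (SLW_of_Pz h)
  obtain ⟨n0, hn0⟩ : ∃ n, ¬ K k A (Fn n) Aᶜ := by
    by_contra! h
    have h1 := K_compl_iUnion h
    have h2 : K k A univ Aᶜ := K_mono h1 (fun x hx => hAF hx.1) Subset.rfl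
    rw [K_compl_iff IsGδ.univ, inter_univ] at h2
    exact hPz h2
  obtain ⟨E, hEC, hEcl, hEnd, hEK⟩ := key_nd hFs hAS' (ker_closed (k := k) (A := A) (S := Aᶜ) (hFn n0))
    (ker_nonempty hn0) ker_NK
  obtain ⟨M, hME, hMcl, hMne, hMP, L, hL, hML, hLd⟩ := main_M hFs hAS' hEcl hEK
  have hMcl' : IsClosed (Subtype.val ⁻¹' M : Set ↥A) := hMcl.preimage continuous_subtype_val
  refine ⟨M, hMcl, hMcl', ?_, ?_, ?_, ?_, ?_⟩
  · rw [hMcl'.isNowhereDense_iff, eq_empty_iff_forall_notMem]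
    intro x hx
    rw [mem_interior_iff_mem_nhds, nhds_subtype_eq_comap] at hx
    obtain ⟨N, hN, hNs⟩ := hx
    obtain ⟨n, hn⟩ := cyl_sub hN
    have hsub : ∀ z ∈ A, z ∈ cylinder x.1 n → z ∈ E := fun z hz hzc =>
      hME (@hNs ⟨z, hz⟩ (hn hzc))
    have hxC := hEC (hsub x.1 x.2 (self_mem_cylinder _ _))
    obtain ⟨y, ⟨hyC, hyc⟩, hyE⟩ := hEnd x.1 hxC n
    obtain ⟨m, hm⟩ := cyl_sub (inter_mem (hEcl.isOpen_compl.mem_nhds hyE) 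
      ((isOpen_cylinder _ x.1 n).mem_nhds hyc))
    obtain ⟨z, hzA, hzC, hzc⟩ := NK_dense (ker_NK (k := k) (A := A) (Z := Fn n0) (S := Aᶜ)) hyC m
    exact (hm hzc).1 (hsub z hzA (hm hzc).2)
  · rintro U hU ⟨x, hxU⟩ hS
    have h1 := Pz_of_SLW (j := fun z : ↥U => z.1.1) 
      (IsEmbedding.subtypeVal.comp IsEmbedding.subtypeVal) hS
    have h2 := hU.mem_nhds hxU
    rw [nhds_subtype_eq_comap] at h2
    obtain ⟨N, hN, hNs⟩ := h2
    obtain ⟨n, hn⟩ := cyl_sub hN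
    apply hMP x.1 x.2.2 n
    have h3 := Pz_inter h1 (isOpen_cylinder _ x.1 n).isGδ
    convert h3 using 1
    ext z
    constructor
    · rintro ⟨hz1, hz2, hz3⟩
      exact ⟨⟨⟨⟨z, hz1, hz2⟩, hNs (hn hz3)⟩, rfl⟩, hz3⟩
    · rintro ⟨⟨w, rfl⟩, hz3⟩
      exact ⟨w.1.2.1, w.1.2.2, hz3⟩
  · have hu : (univ : Set ↥(A ∩ M)) ⊆ ⋃ n, Subtype.val ⁻¹' (L n) := by
      rintro x -
      obtain ⟨n, hn⟩ := mem_iUnion.1 (hML x.2)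
      exact mem_iUnion.2 ⟨n, hn⟩
    refine IsMeagre.mono hu (isMeagre_iUnion fun n => IsNowhereDense.isMeagre ?_)
    rw [((hL n).preimage continuous_subtype_val).isNowhereDense_iff, eq_empty_iff_forall_notMem]
    intro x hx
    rw [mem_interior_iff_mem_nhds, nhds_subtype_eq_comap] at hx
    obtain ⟨N, hN, hNs⟩ := hx
    obtain ⟨j, hj⟩ := cyl_sub hN
    obtain ⟨y, hy, hyc, hyL⟩ := hLd n x.1 x.2 j
    exact hyL (@hNs ⟨y, hy⟩ (hj hyc))
  · exact hME.trans (hEC.trans (ker_sub.trans (subset_iUnion Fn n0)))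
  · refine homeo_star hk hMcl hMne fun y hy m hw => hMP y hy m (Pz_LWs ?_)
    intro z hz
    exact ⟨0, wlt_mono (fun w hw => hw.1.2) hw⟩

end HF

end

/-- Theorem `hf`: inside an `F_σ`-set `F ⊆ B*(k)` containing a co-Souslin
set `A` which is not `σLW(<k) + 𝒢_δσ`, one can find a closed copy `M` of `B*(k)` with
`M ⊆ F` whose trace on `A` is nowhere dense closed in `A`, of first category and nowhere
`σLW(<k) + 𝒢_δσ`. -/
theorem stmt_4 (k : Cardinal.{u}) (hk : Cardinal.aleph0 ≤ k)
    (F A : Set (BaireStar k)) (hF : IsFsigmaSet F) (hAF : A ⊆ F)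
    (hco : IsSuslinIn Aᶜ) (hA : ¬ SLWplusGDS ↥A k) :
    ∃ M : Set (BaireStar k), IsClosed M ∧
      IsClosed (Subtype.val ⁻¹' M : Set ↥A) ∧
      IsNowhereDense (Subtype.val ⁻¹' M : Set ↥A) ∧
      NowhereSLWplusGDS ↥(A ∩ M) k ∧ FirstCategory ↥(A ∩ M) ∧
      M ⊆ F ∧ Nonempty (↥M ≃ₜ BaireStar k) := by
  exact HF.final k hk F A hF hAF hco hA
end
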